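/- arXiv:1704.00122 — 4 statements merged into one kernel-verified Lean document; each statement's English description precedes it below -/
import Mathlib

section
/- Let A and B be n×n complex positive definite matrices, set C = A^{-1}(A#B), and let D be the (real) Fréchet derivative of the geometric mean map G(A,B) = A#B at (A,B). Then for all Hermitian matrices X, Y: ‖D(X,Y)‖ ≤ (∫₀^∞ ‖exp(-t C)‖² dt)·(1 + ‖C‖²)·max(‖X‖, ‖Y‖). -/
open Matrix MeasureTheory Real
open scoped Matrix.Norms.L2Operator ComplexOrder

-- `psqrt M` is the unique positive semidefinite square root of a positive semidefinite matrix
open Classical in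
noncomputable def psqrt {n : ℕ} (M : Matrix (Fin n) (Fin n) ℂ) : Matrix (Fin n) (Fin n) ℂ :=
  if h : M.PosSemidef then
    h.1.eigenvectorUnitary.1 * diagonal ((↑) ∘ Real.sqrt ∘ h.1.eigenvalues) *
      (star h.1.eigenvectorUnitary : Matrix (Fin n) (Fin n) ℂ)
  else 0

-- the geometric mean  A#B = A^{1/2} (A^{-1/2} B A^{-1/2})^{1/2} A^{1/2}
noncomputable def gm {n : ℕ} (A B : Matrix (Fin n) (Fin n) ℂ) : Matrix (Fin n) (Fin n) ℂ :=
  psqrt A * psqrt ((psqrt A)⁻¹ * B * (psqrt A)⁻¹) * psqrt A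

-- entrywise complex conjugate
def mconj {n : ℕ} (M : Matrix (Fin n) (Fin n) ℂ) : Matrix (Fin n) (Fin n) ℂ := Mᴴᵀ

-- smallest eigenvalue of a Hermitian matrix
noncomputable def lmin {n : ℕ} {C : Matrix (Fin n) (Fin n) ℂ} (hC : C.IsHermitian) : ℝ :=
  ⨅ i, hC.eigenvalues i


lemma psqrt_form {n : ℕ} {M : Matrix (Fin n) (Fin n) ℂ} (h : M.PosDef) :
    ∃ (U : Matrix (Fin n) (Fin n) ℂ) (d : Fin n → ℝ), (∀ i, 0 < d i) ∧ U * Uᴴ = 1 ∧ Uᴴ * U = 1 ∧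
      psqrt M = U * diagonal (fun i => (d i : ℂ)) * Uᴴ ∧
      M = U * diagonal (fun i => ((d i * d i : ℝ) : ℂ)) * Uᴴ := by
  have hs := h.posSemidef
  refine ⟨h.1.eigenvectorUnitary.1, fun i => √(h.1.eigenvalues i),
    fun i => Real.sqrt_pos.mpr (h.eigenvalues_pos i), ?_, ?_, ?_, ?_⟩
  · exact Unitary.mul_star_self_of_mem h.1.eigenvectorUnitary.2
  · exact Unitary.star_mul_self_of_mem h.1.eigenvectorUnitary.2
  · rw [psqrt, dif_pos hs]; rfl
  · conv_lhs => rw [h.1.spectral_theorem, Unitary.conjStarAlgAut_apply]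
    congr 3
    ext i
    simp only [Function.comp]
    rw [Real.mul_self_sqrt (h.eigenvalues_pos i).le]
    rfl

lemma psqrt_mul {n : ℕ} {M : Matrix (Fin n) (Fin n) ℂ} (h : M.PosDef) :
    psqrt M * psqrt M = M := by
  obtain ⟨U, d, hd, h1, h2, h3, h4⟩ := psqrt_form h
  rw [h3]
  conv_rhs => rw [h4]
  calc _ = U * diagonal (fun i => (d i : ℂ)) * (Uᴴ * U) * diagonal (fun i => (d i : ℂ)) * Uᴴ := by
        simp only [Matrix.mul_assoc]
    _ = _ := by
        rw [h2, Matrix.mul_one, Matrix.mul_assoc U, diagonal_mul_diagonal]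
        simp

lemma psqrt_herm {n : ℕ} {M : Matrix (Fin n) (Fin n) ℂ} (h : M.PosDef) :
    (psqrt M)ᴴ = psqrt M := by
  obtain ⟨U, d, hd, h1, h2, h3, h4⟩ := psqrt_form h
  rw [h3]
  simp only [conjTranspose_mul, conjTranspose_conjTranspose, diagonal_conjTranspose, Matrix.mul_assoc]
  congr 3
  ext i
  simp

lemma psqrt_isUnit {n : ℕ} {M : Matrix (Fin n) (Fin n) ℂ} (h : M.PosDef) :
    IsUnit (psqrt M) := by
  have := h.isUnit
  rw [← psqrt_mul h] at this
  rw [Matrix.isUnit_iff_isUnit_det] at this ⊢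
  rw [det_mul] at this
  exact isUnit_of_mul_isUnit_left this

lemma inner_posDef {n : ℕ} {A B : Matrix (Fin n) (Fin n) ℂ} (hA : A.PosDef) (hB : B.PosDef) :
    ((psqrt A)⁻¹ * B * (psqrt A)⁻¹).PosDef := by
  have hu : IsUnit (psqrt A)⁻¹ := by
    rw [Matrix.isUnit_nonsing_inv_iff]; exact psqrt_isUnit hA
  have := (Matrix.IsUnit.posDef_star_right_conjugate_iff (x := B) hu).2 hB
  rwa [star_eq_conjTranspose, conjTranspose_nonsing_inv, psqrt_herm hA] at this

lemma gm_herm {n : ℕ} {A B : Matrix (Fin n) (Fin n) ℂ} (hA : A.PosDef) (hB : B.PosDef) :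
    (gm A B)ᴴ = gm A B := by
  rw [gm, conjTranspose_mul, conjTranspose_mul, psqrt_herm hA, psqrt_herm (inner_posDef hA hB),
    ← Matrix.mul_assoc]

lemma inv_eq' {n : ℕ} {A : Matrix (Fin n) (Fin n) ℂ} (hA : A.PosDef) :
    A⁻¹ = (psqrt A)⁻¹ * (psqrt A)⁻¹ := by
  rw [← Matrix.mul_inv_rev, psqrt_mul hA]

lemma gm_ric {n : ℕ} {A B : Matrix (Fin n) (Fin n) ℂ} (hA : A.PosDef) (hB : B.PosDef) :
    gm A B * A⁻¹ * gm A B = B := by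
  have hu := (Matrix.isUnit_iff_isUnit_det _).1 (psqrt_isUnit hA)
  have hP := psqrt_mul (inner_posDef hA hB)
  rw [inv_eq' hA, gm]
  set S := psqrt A
  set P := psqrt (S⁻¹ * B * S⁻¹)
  have h1 : S * S⁻¹ = 1 := mul_nonsing_inv _ hu
  have h2 : S⁻¹ * S = 1 := nonsing_inv_mul _ hu
  calc _ = S * P * (S * S⁻¹) * (S⁻¹ * S) * P * S := by simp only [Matrix.mul_assoc]
    _ = S * (P * P) * S := by simp only [h1, h2, Matrix.mul_one, Matrix.mul_assoc]
    _ = (S * S⁻¹) * B * (S⁻¹ * S) := by rw [hP]; simp only [Matrix.mul_assoc]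
    _ = B := by simp [h1, h2]

lemma C_form {n : ℕ} {A B : Matrix (Fin n) (Fin n) ℂ} (hA : A.PosDef) (hB : B.PosDef) :
    ∃ (V W : Matrix (Fin n) (Fin n) ℂ) (d : Fin n → ℝ), (∀ i, 0 < d i) ∧ V * W = 1 ∧ W * V = 1 ∧
      A⁻¹ * gm A B = V * diagonal (fun i => (d i : ℂ)) * W := by
  obtain ⟨U, d, hd, h1, h2, h3, h4⟩ := psqrt_form (inner_posDef hA hB)
  have hu := (Matrix.isUnit_iff_isUnit_det _).1 (psqrt_isUnit hA)
  have e1 : psqrt A * (psqrt A)⁻¹ = 1 := mul_nonsing_inv _ hu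
  have e2 : (psqrt A)⁻¹ * psqrt A = 1 := nonsing_inv_mul _ hu
  have hVW : (psqrt A)⁻¹ * U * (Uᴴ * psqrt A) = 1 := by
    calc _ = (psqrt A)⁻¹ * (U * Uᴴ) * psqrt A := by simp only [Matrix.mul_assoc]
      _ = 1 := by rw [h1, Matrix.mul_one, e2]
  refine ⟨(psqrt A)⁻¹ * U, Uᴴ * psqrt A, d, hd, hVW, mul_eq_one_comm.1 hVW, ?_⟩
  rw [inv_eq' hA, gm, h3]
  calc _ = (psqrt A)⁻¹ * ((psqrt A)⁻¹ * psqrt A) * (U * diagonal (fun i => (d i : ℂ)) * Uᴴ) * psqrt A := by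
        simp only [Matrix.mul_assoc]
    _ = _ := by rw [e2]; simp only [Matrix.mul_assoc, Matrix.mul_one]

lemma exp_bound {n : ℕ} {A B : Matrix (Fin n) (Fin n) ℂ} (hA : A.PosDef) (hB : B.PosDef) :
    ∃ K m : ℝ, 0 < m ∧ 0 ≤ K ∧ ∀ t : ℝ, 0 ≤ t →
      ‖NormedSpace.exp ((-t) • (A⁻¹ * gm A B))‖ ≤ K * Real.exp (-m * t) := by
  obtain ⟨V, W, d, hd, hVW, hWV, hC⟩ := C_form hA hB
  obtain ⟨m, hm, hmd⟩ : ∃ m : ℝ, 0 < m ∧ ∀ i, m ≤ d i := by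
    rcases isEmpty_or_nonempty (Fin n) with h | h
    · exact ⟨1, one_pos, fun i => h.elim i⟩
    · obtain ⟨i, hi⟩ := Finite.exists_min d
      exact ⟨d i, hd i, hi⟩
  refine ⟨‖V‖ * ‖W‖, m, hm, by positivity, fun t ht => ?_⟩
  have hexp : NormedSpace.exp ((-t) • (A⁻¹ * gm A B)) =
      V * diagonal (fun i => ((Real.exp (-t * d i) : ℝ) : ℂ)) * W := by
    have e : (-t) • (A⁻¹ * gm A B) = V * ((-t) • diagonal (fun i => (d i : ℂ))) * W := by
      rw [hC]; simp
    have hWi : V⁻¹ = W := Matrix.inv_eq_right_inv hVW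
    have hV : IsUnit V := ⟨⟨V, W, hVW, hWV⟩, rfl⟩
    rw [e, ← hWi, Matrix.exp_conj _ _ hV, ← Matrix.diagonal_smul, Matrix.exp_diagonal]
    congr 3
    ext i
    rw [Pi.coe_exp]
    simp [← Complex.exp_eq_exp_ℂ]
  rw [hexp]
  have hdn : ‖(diagonal (fun i => ((Real.exp (-t * d i) : ℝ) : ℂ)) : Matrix (Fin n) (Fin n) ℂ)‖
      ≤ Real.exp (-m * t) := by
    rw [Matrix.l2_opNorm_diagonal, pi_norm_le_iff_of_nonneg (Real.exp_pos _).le]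
    intro i
    rw [Complex.norm_real, Real.norm_of_nonneg (Real.exp_pos _).le]
    apply Real.exp_le_exp.2
    nlinarith [hmd i]
  calc _ ≤ ‖V‖ * ‖(diagonal (fun i => ((Real.exp (-t * d i) : ℝ) : ℂ)) : Matrix (Fin n) (Fin n) ℂ)‖ * ‖W‖ :=
        (norm_mul_le _ _).trans (by gcongr; exact norm_mul_le _ _)
    _ ≤ ‖V‖ * Real.exp (-m * t) * ‖W‖ := by gcongr
    _ = _ := by ring

lemma posDef_perturb {n : ℕ} {A X : Matrix (Fin n) (Fin n) ℂ} (hA : A.PosDef)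
    (hX : X.IsHermitian) : ∀ᶠ t : ℝ in nhds 0, (A + t • X).PosDef := by
  have hu := psqrt_isUnit hA
  have hu' := (Matrix.isUnit_iff_isUnit_det _).1 hu
  have e1 : psqrt A * (psqrt A)⁻¹ = 1 := mul_nonsing_inv _ hu'
  have e2 : (psqrt A)⁻¹ * psqrt A = 1 := nonsing_inv_mul _ hu'
  have hZ : ((psqrt A)⁻¹ * X * (psqrt A)⁻¹).IsHermitian := by
    rw [IsHermitian]
    simp only [conjTranspose_mul, conjTranspose_nonsing_inv, psqrt_herm hA, hX.eq, Matrix.mul_assoc]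
  have hev : ∀ᶠ t : ℝ in nhds 0, ∀ i, 0 < 1 + t * hZ.eigenvalues i := by
    rw [Filter.eventually_all]
    intro i
    have : ContinuousAt (fun t : ℝ => 1 + t * hZ.eigenvalues i) 0 := by fun_prop
    exact this.eventually (lt_mem_nhds (by simp))
  filter_upwards [hev] with t ht
  set U : Matrix (Fin n) (Fin n) ℂ := hZ.eigenvectorUnitary.1
  have hU1 : U * Uᴴ = 1 := Unitary.mul_star_self_of_mem hZ.eigenvectorUnitary.2
  have hU2 : Uᴴ * U = 1 := Unitary.star_mul_self_of_mem hZ.eigenvectorUnitary.2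
  have hsp : (psqrt A)⁻¹ * X * (psqrt A)⁻¹ =
      U * diagonal (fun i => (hZ.eigenvalues i : ℂ)) * Uᴴ := by
    conv_lhs => rw [hZ.spectral_theorem, Unitary.conjStarAlgAut_apply]
    rfl
  have hd : (diagonal (fun i => ((1 + t * hZ.eigenvalues i : ℝ) : ℂ))).PosDef := by
    apply Matrix.PosDef.diagonal
    intro i
    exact_mod_cast ht i
  have hUu : IsUnit (psqrt A * U) := hu.mul ⟨⟨U, Uᴴ, hU1, hU2⟩, rfl⟩
  have := (Matrix.IsUnit.posDef_star_right_conjugate_iff hUu).2 hd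
  convert this using 1
  have hdd : diagonal (fun i => ((1 + t * hZ.eigenvalues i : ℝ) : ℂ)) =
      1 + t • diagonal (fun i => (hZ.eigenvalues i : ℂ)) := by
    rw [← Matrix.diagonal_smul, ← Matrix.diagonal_one, Matrix.diagonal_add]
    congr 1
    ext i
    simp
  rw [hdd, star_eq_conjTranspose, conjTranspose_mul, psqrt_herm hA]
  calc A + t • X = psqrt A * psqrt A + t • ((psqrt A * (psqrt A)⁻¹) * X * ((psqrt A)⁻¹ * psqrt A)) := by
        rw [e1, e2, psqrt_mul hA]; simp
    _ = psqrt A * (1 + t • ((psqrt A)⁻¹ * X * (psqrt A)⁻¹)) * psqrt A := by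
        simp only [Matrix.mul_add, Matrix.add_mul, Matrix.mul_one, Matrix.mul_smul, Matrix.smul_mul,
          Matrix.mul_assoc]
    _ = psqrt A * (U * Uᴴ + t • (U * diagonal (fun i => (hZ.eigenvalues i : ℂ)) * Uᴴ)) * psqrt A := by
        rw [hU1]; exact congrArg (fun Z => psqrt A * (1 + t • Z) * psqrt A) hsp
    _ = _ := by
        simp only [Matrix.mul_add, Matrix.add_mul, Matrix.mul_one, Matrix.mul_smul, Matrix.smul_mul,
          Matrix.mul_assoc]

/-- The Lyapunov equation satisfied by the derivative. -/
lemma lyap {n : ℕ} {A B : Matrix (Fin n) (Fin n) ℂ}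
    (hA : A.PosDef) (hB : B.PosDef)
    (D : Matrix (Fin n) (Fin n) ℂ × Matrix (Fin n) (Fin n) ℂ →L[ℝ] Matrix (Fin n) (Fin n) ℂ)
    (hD : HasFDerivWithinAt (fun p : Matrix (Fin n) (Fin n) ℂ × Matrix (Fin n) (Fin n) ℂ =>
        gm p.1 p.2) D
      {p : Matrix (Fin n) (Fin n) ℂ × Matrix (Fin n) (Fin n) ℂ |
        p.1.IsHermitian ∧ p.2.IsHermitian} (A, B))
    (X Y : Matrix (Fin n) (Fin n) ℂ) (hX : X.IsHermitian) (hY : Y.IsHermitian) :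
    D (X, Y) * (A⁻¹ * gm A B) + (A⁻¹ * gm A B)ᴴ * D (X, Y) =
      Y + (A⁻¹ * gm A B)ᴴ * X * (A⁻¹ * gm A B) := by
  have hline : HasDerivAt (fun t : ℝ => ((A + t • X, B + t • Y) :
      Matrix (Fin n) (Fin n) ℂ × Matrix (Fin n) (Fin n) ℂ)) (X, Y) 0 := by
    apply HasDerivAt.prodMk
    · simpa using ((hasDerivAt_id (0 : ℝ)).smul_const X).const_add A
    · simpa using ((hasDerivAt_id (0 : ℝ)).smul_const Y).const_add B
  have hG : HasDerivAt (fun t : ℝ => gm (A + t • X) (B + t • Y)) (D (X, Y)) 0 := by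
    have h0 : HasFDerivWithinAt (fun p : Matrix (Fin n) (Fin n) ℂ × Matrix (Fin n) (Fin n) ℂ =>
        gm p.1 p.2) D
      {p : Matrix (Fin n) (Fin n) ℂ × Matrix (Fin n) (Fin n) ℂ |
        p.1.IsHermitian ∧ p.2.IsHermitian} (A + (0 : ℝ) • X, B + (0 : ℝ) • Y) := by
      simpa using hD
    have := h0.comp_hasDerivWithinAt (s := Set.univ) (0 : ℝ) hline.hasDerivWithinAt (by
      intro t _
      refine ⟨hA.1.add ?_, hB.1.add ?_⟩
      · rw [IsHermitian, conjTranspose_smul, hX.eq]; simp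
      · rw [IsHermitian, conjTranspose_smul, hY.eq]; simp)
    exact hasDerivWithinAt_univ.1 this
  have hI : HasDerivAt (fun t : ℝ => (A + t • X)⁻¹) (-(A⁻¹ * X * A⁻¹)) 0 := by
    obtain ⟨u, hu⟩ := hA.isUnit
    have hi : (↑u⁻¹ : Matrix (Fin n) (Fin n) ℂ) = A⁻¹ := by
      rw [← hu, Matrix.coe_units_inv]
    have h1 := hasFDerivAt_ringInverse (𝕜 := ℝ) u
    have h2 : HasDerivAt (fun t : ℝ => A + t • X) X 0 := by
      simpa using ((hasDerivAt_id (0 : ℝ)).smul_const X).const_add A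
    have h1' : HasFDerivAt Ring.inverse
        (-ContinuousLinearMap.mulLeftRight ℝ (Matrix (Fin n) (Fin n) ℂ) ↑u⁻¹ ↑u⁻¹) (A + (0 : ℝ) • X) := by
      simpa [hu] using h1
    have h3 := h1'.comp_hasDerivAt (0 : ℝ) h2
    simp only [_root_.neg_apply, ContinuousLinearMap.mulLeftRight_apply, hi] at h3
    refine h3.congr_of_eventuallyEq (Filter.Eventually.of_forall fun t => ?_)
    simp [Matrix.nonsing_inv_eq_ringInverse]
  have hL := (hG.mul hI).mul hG
  have hR : HasDerivAt (fun t : ℝ => B + t • Y) Y 0 := by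
    simpa using ((hasDerivAt_id (0 : ℝ)).smul_const Y).const_add B
  have heq : (fun t : ℝ => B + t • Y) =ᶠ[nhds 0]
      (fun t : ℝ => gm (A + t • X) (B + t • Y) * (A + t • X)⁻¹ * gm (A + t • X) (B + t • Y)) := by
    filter_upwards [posDef_perturb hA hX, posDef_perturb hB hY] with t h1 h2
    exact (gm_ric h1 h2).symm
  have key := (hL.congr_of_eventuallyEq heq).unique hR
  simp only [Pi.mul_apply, zero_smul, add_zero, Matrix.mul_neg] at key
  have hCs : (A⁻¹ * gm A B)ᴴ = gm A B * A⁻¹ := by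
    rw [conjTranspose_mul, gm_herm hA hB, conjTranspose_nonsing_inv, hA.1.eq]
  rw [hCs]
  generalize D (X, Y) = H at key ⊢
  rw [← key]
  noncomm_ring

lemma main_bound {n : ℕ} {C H R : Matrix (Fin n) (Fin n) ℂ} {K m : ℝ} (hm : 0 < m)
    (hK : 0 ≤ K)
    (hb : ∀ t : ℝ, 0 ≤ t → ‖NormedSpace.exp ((-t) • C)‖ ≤ K * Real.exp (-m * t))
    (hH : H * C + Cᴴ * H = R) :
    ‖H‖ ≤ (∫ t in Set.Ioi (0 : ℝ), ‖NormedSpace.exp ((-t) • C)‖ ^ 2) * ‖R‖ := by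
  have hE : ∀ (M : Matrix (Fin n) (Fin n) ℂ) (t : ℝ), HasDerivAt (fun t : ℝ => NormedSpace.exp ((-t) • M))
      (-(NormedSpace.exp ((-t) • M) * M)) t := by
    intro M t
    have := (hasDerivAt_exp_smul_const (𝕂 := ℝ) (-M) t)
    simpa using this
  have hE' : ∀ (M : Matrix (Fin n) (Fin n) ℂ) (t : ℝ), HasDerivAt (fun t : ℝ => NormedSpace.exp ((-t) • M))
      (-(M * NormedSpace.exp ((-t) • M))) t := by
    intro M t
    have := (hasDerivAt_exp_smul_const' (𝕂 := ℝ) (-M) t)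
    simpa using this
  have hstar : ∀ t : ℝ, NormedSpace.exp ((-t) • Cᴴ) = (NormedSpace.exp ((-t) • C))ᴴ := by
    intro t
    rw [← Matrix.exp_conjTranspose, conjTranspose_smul]; simp
  have hns : ∀ t : ℝ, ‖NormedSpace.exp ((-t) • Cᴴ)‖ = ‖NormedSpace.exp ((-t) • C)‖ := by
    intro t; rw [hstar, Matrix.l2_opNorm_conjTranspose]
  have hcont : ∀ M : Matrix (Fin n) (Fin n) ℂ, Continuous (fun t : ℝ => NormedSpace.exp ((-t) • M)) :=
    fun M => continuous_iff_continuousAt.2 fun t => (hE M t).continuousAt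
  have hnb : ∀ (Q : Matrix (Fin n) (Fin n) ℂ) (t : ℝ),
      ‖NormedSpace.exp ((-t) • Cᴴ) * Q * NormedSpace.exp ((-t) • C)‖ ≤
        ‖NormedSpace.exp ((-t) • C)‖ ^ 2 * ‖Q‖ := by
    intro Q t
    calc _ ≤ ‖NormedSpace.exp ((-t) • Cᴴ)‖ * ‖Q‖ * ‖NormedSpace.exp ((-t) • C)‖ :=
        (norm_mul_le _ _).trans (by gcongr; exact norm_mul_le _ _)
      _ = _ := by rw [hns]; ring
  have hsq : ∀ t : ℝ, 0 ≤ t → ‖NormedSpace.exp ((-t) • C)‖ ^ 2 ≤ K ^ 2 * Real.exp (-(2 * m) * t) := by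
    intro t ht
    calc _ ≤ (K * Real.exp (-m * t)) ^ 2 := by gcongr; exact hb t ht
      _ = _ := by rw [mul_pow, ← Real.exp_nat_mul]; congr 2; push_cast; ring
  have hIntA : IntegrableOn (fun t : ℝ => ‖NormedSpace.exp ((-t) • C)‖ ^ 2) (Set.Ioi 0) := by
    have h1 : IntegrableOn (fun t : ℝ => K ^ 2 * Real.exp (-(2 * m) * t)) (Set.Ioi 0) :=
      (integrableOn_exp_mul_Ioi (by linarith) 0).const_mul _
    refine Integrable.mono' h1 ((hcont C).norm.pow 2).aestronglyMeasurable ?_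
    filter_upwards [ae_restrict_mem measurableSet_Ioi] with t ht
    rw [Real.norm_of_nonneg (by positivity)]
    exact hsq t (le_of_lt ht)
  have hder : ∀ t : ℝ, HasDerivAt
      (fun t : ℝ => NormedSpace.exp ((-t) • Cᴴ) * H * NormedSpace.exp ((-t) • C))
      (-(NormedSpace.exp ((-t) • Cᴴ) * R * NormedSpace.exp ((-t) • C))) t := by
    intro t
    have := ((hE Cᴴ t).mul_const H).mul (hE' C t)
    have e : -(NormedSpace.exp ((-t) • Cᴴ) * R * NormedSpace.exp ((-t) • C)) =
        -(NormedSpace.exp ((-t) • Cᴴ) * Cᴴ) * H * NormedSpace.exp ((-t) • C) +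
      NormedSpace.exp ((-t) • Cᴴ) * H * -(C * NormedSpace.exp ((-t) • C)) := by
      rw [← hH]
      noncomm_ring
    rw [e]
    exact this
  have hlim : Filter.Tendsto
      (fun t : ℝ => NormedSpace.exp ((-t) • Cᴴ) * H * NormedSpace.exp ((-t) • C)) Filter.atTop (nhds 0) := by
    have h1 : Filter.Tendsto (fun t : ℝ => K ^ 2 * Real.exp (-(2 * m) * t) * ‖H‖) Filter.atTop (nhds 0) := by
      have h2 : Filter.Tendsto (fun t : ℝ => Real.exp (-(2 * m) * t)) Filter.atTop (nhds 0) := by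
        apply Real.tendsto_exp_atBot.comp
        exact Filter.tendsto_id.const_mul_atTop_of_neg (by linarith)
      simpa using (h2.const_mul (K ^ 2)).mul_const ‖H‖
    refine squeeze_zero_norm' ?_ h1
    filter_upwards [Filter.eventually_ge_atTop 0] with t ht
    exact (hnb H t).trans (by gcongr; exact hsq t ht)
  have hIntB : IntegrableOn (fun t : ℝ =>
      -(NormedSpace.exp ((-t) • Cᴴ) * R * NormedSpace.exp ((-t) • C))) (Set.Ioi 0) := by
    refine Integrable.mono' (hIntA.mul_const ‖R‖)
      (((hcont Cᴴ).mul continuous_const).mul (hcont C)).neg.aestronglyMeasurable ?_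
    exact Filter.Eventually.of_forall fun t => by rw [norm_neg]; exact hnb R t
  have hFTC := integral_Ioi_of_hasDerivAt_of_tendsto' (fun t _ => hder t) hIntB hlim
  have hH0 : H = -∫ t in Set.Ioi (0 : ℝ),
      -(NormedSpace.exp ((-t) • Cᴴ) * R * NormedSpace.exp ((-t) • C)) := by
    rw [hFTC]; simp
  rw [hH0, norm_neg, ← integral_mul_const]
  refine norm_integral_le_of_norm_le (hIntA.mul_const _) ?_
  exact Filter.Eventually.of_forall fun t => by rw [norm_neg]; exact hnb R t

/-- bound on the derivative of the geometric mean map: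
`‖D(X,Y)‖ ≤ (∫₀^∞ ‖exp(-t C)‖² dt) (1 + ‖C‖²) max(‖X‖, ‖Y‖)`. -/
theorem stmt2 {n : ℕ} (hn : 0 < n) (A B : Matrix (Fin n) (Fin n) ℂ)
    (hA : A.PosDef) (hB : B.PosDef)
    (C : Matrix (Fin n) (Fin n) ℂ) (hC : C = A⁻¹ * gm A B)
    (D : Matrix (Fin n) (Fin n) ℂ × Matrix (Fin n) (Fin n) ℂ →L[ℝ] Matrix (Fin n) (Fin n) ℂ)
    (hD : HasFDerivWithinAt (fun p : Matrix (Fin n) (Fin n) ℂ × Matrix (Fin n) (Fin n) ℂ =>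
        gm p.1 p.2) D
      {p : Matrix (Fin n) (Fin n) ℂ × Matrix (Fin n) (Fin n) ℂ |
        p.1.IsHermitian ∧ p.2.IsHermitian} (A, B)) :
    ∀ X Y : Matrix (Fin n) (Fin n) ℂ, X.IsHermitian → Y.IsHermitian →
      ‖D (X, Y)‖ ≤ (∫ t in Set.Ioi (0 : ℝ), ‖NormedSpace.exp ((-t) • C)‖ ^ 2) *
        (1 + ‖C‖ ^ 2) * max ‖X‖ ‖Y‖ := by
  intro X Y hX hY
  obtain ⟨K, m, hm, hK, hb⟩ := exp_bound hA hB
  have hl := lyap hA hB D hD X Y hX hY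
  rw [← hC] at hb hl
  have h := main_bound hm hK hb hl
  rw [mul_assoc]
  refine h.trans (mul_le_mul_of_nonneg_left ?_ (integral_nonneg fun t => by positivity))
  calc ‖Y + Cᴴ * X * C‖ ≤ ‖Y‖ + ‖Cᴴ‖ * ‖X‖ * ‖C‖ :=
        (norm_add_le _ _).trans (by
          gcongr; exact (norm_mul_le _ _).trans (by gcongr; exact norm_mul_le _ _))
    _ = ‖Y‖ + ‖C‖ ^ 2 * ‖X‖ := by rw [Matrix.l2_opNorm_conjTranspose]; ring
    _ ≤ max ‖X‖ ‖Y‖ + ‖C‖ ^ 2 * max ‖X‖ ‖Y‖ := by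
        gcongr
        · exact le_max_right _ _
        · exact le_max_left _ _
    _ = _ := by ring
end

section
/- Let A and B be n×n complex positive definite matrices and let D be the (real) Fréchet derivative of the geometric mean map G(A,B) = A#B at (A,B). Then D is a positive linear map: if X and Y are positive semidefinite Hermitian matrices, then D(X,Y) is positive semidefinite. Moreover, the operator norm of D is attained at the identity: sup{‖D(X,Y)‖ : X, Y Hermitian with max(‖X‖,‖Y‖) ≤ 1} = ‖D(I,I)‖. -/
open Matrix MeasureTheory Real
open scoped Matrix.Norms.L2Operator ComplexOrder

section generic
variable {E : Type*} [CStarAlgebra E] [PartialOrder E] [StarOrderedRing E]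
lemma norm_le_of_abs_le {x a : E} (ha : 0 ≤ a) (hx : IsSelfAdjoint x)
    (h1 : -a ≤ x) (h2 : x ≤ a) : ‖x‖ ≤ ‖a‖ := by
  have h3 := IsSelfAdjoint.le_algebraMap_norm_self (IsSelfAdjoint.of_nonneg ha)
  have h4 := (le_algebraMap_iff_spectrum_le (R := ℝ) hx).1 (h2.trans h3)
  have h5 := (algebraMap_le_iff_le_spectrum (R := ℝ) (r := -‖a‖) hx).1
    (by rw [map_neg]; exact (neg_le_neg h3).trans h1)
  rcases subsingleton_or_nontrivial E with h | h
  · simp [Subsingleton.elim x a]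
  · rcases CStarAlgebra.norm_or_neg_norm_mem_spectrum (a := x) hx with h | h
    · exact h4 _ h
    · linarith [h5 _ h]

lemma one_sub_add_nonneg {Z : E} (hZ : IsSelfAdjoint Z) (h : ‖Z‖ ≤ 1) : 0 ≤ 1 - Z ∧ 0 ≤ 1 + Z := by
  have h0 : algebraMap ℝ E ‖Z‖ ≤ 1 := by
    rw [← map_one (algebraMap ℝ E)]
    exact algebraMap_mono _ h
  have h1 := IsSelfAdjoint.le_algebraMap_norm_self hZ
  have h2 := IsSelfAdjoint.neg_algebraMap_norm_le_self hZ
  refine ⟨sub_nonneg.2 (h1.trans h0), ?_⟩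
  exact neg_le_iff_add_nonneg'.1 ((neg_le_neg h0).trans h2)
end generic

section
open scoped MatrixOrder
variable {n : ℕ}
lemma psqrt_nonneg (M : Matrix (Fin n) (Fin n) ℂ) : 0 ≤ psqrt M := by
  unfold psqrt
  split_ifs with h
  · rw [Matrix.nonneg_iff_posSemidef]
    have : (diagonal ((↑) ∘ Real.sqrt ∘ h.1.eigenvalues : Fin n → ℂ)).PosSemidef := by
      refine PosSemidef.diagonal fun i => ?_
      simp [Real.sqrt_nonneg]
    simpa [star_eq_conjTranspose] using this.mul_mul_conjTranspose_same (h.1.eigenvectorUnitary.1)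
  · exact le_rfl

lemma psqrt_mul_self {M : Matrix (Fin n) (Fin n) ℂ} (h : 0 ≤ M) : psqrt M * psqrt M = M := by
  have h' := Matrix.nonneg_iff_posSemidef.1 h
  rw [psqrt, dif_pos h']
  have hU : (star h'.1.eigenvectorUnitary : Matrix (Fin n) (Fin n) ℂ) * h'.1.eigenvectorUnitary.1 = 1 := 
    Unitary.coe_star_mul_self _
  conv_rhs => rw [h'.1.spectral_theorem]
  have hd : (diagonal ((↑) ∘ Real.sqrt ∘ h'.1.eigenvalues : Fin n → ℂ)) * (diagonal ((↑) ∘ Real.sqrt ∘ h'.1.eigenvalues : Fin n → ℂ)) = diagonal ((↑) ∘ h'.1.eigenvalues : Fin n → ℂ) := by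
    rw [diagonal_mul_diagonal]
    congr 1; ext i
    simp only [Function.comp]
    rw [← Complex.ofReal_mul, Real.mul_self_sqrt (h'.eigenvalues_nonneg i)]
  rw [Unitary.conjStarAlgAut_apply]
  generalize (star h'.1.eigenvectorUnitary : Matrix (Fin n) (Fin n) ℂ) = V at *
  change _ = _ * diagonal ((↑) ∘ h'.1.eigenvalues : Fin n → ℂ) * _
  rw [← hd]
  simp only [Matrix.mul_assoc]
  rw [← Matrix.mul_assoc V, hU, Matrix.one_mul]

lemma le_psqrt {P Q : Matrix (Fin n) (Fin n) ℂ} (hP : 0 ≤ P) (h : P * P ≤ Q) : P ≤ psqrt Q := by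
  have hPP : 0 ≤ P * P := by
    have := star_mul_self_nonneg P
    rwa [(IsSelfAdjoint.of_nonneg hP).star_eq] at this
  have h1 : CFC.sqrt Q = psqrt Q := CFC.sqrt_unique (psqrt_mul_self (hPP.trans h)) (psqrt_nonneg Q)
  rw [← h1, ← CFC.sqrt_mul_self P hP]
  exact CFC.sqrt_le_sqrt _ _ h

lemma gm_mono {A B A' B' : Matrix (Fin n) (Fin n) ℂ} (hA : A.PosDef) (hB : 0 ≤ B)
    (hAA : A ≤ A') (hBB : B ≤ B') : gm A B ≤ gm A' B' := by
  have hA0 : 0 ≤ A := hA.posSemidef.nonneg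
  have hA' : A'.PosDef := by
    have := hA.add_posSemidef (Matrix.le_iff.1 hAA)
    simpa using this
  have hA0' : 0 ≤ A' := hA'.posSemidef.nonneg
  have inv_le : A'⁻¹ ≤ A⁻¹ := by
    have := CStarAlgebra.inv_le_inv (a := hA.isUnit.unit) (b := hA'.isUnit.unit) hA0 hAA
    simpa [Matrix.coe_units_inv] using this
  unfold gm
  have conj : ∀ {S M N : Matrix (Fin n) (Fin n) ℂ}, IsSelfAdjoint S → M ≤ N → S * M * S ≤ S * N * S := by
    intro S M N hS h
    simpa [hS.star_eq] using star_left_conjugate_le_conjugate h S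
  have nn : ∀ {S M : Matrix (Fin n) (Fin n) ℂ}, IsSelfAdjoint S → 0 ≤ M → 0 ≤ S * M * S := by
    intro S M hS h
    simpa using conj hS h
  have hinv : ∀ {S : Matrix (Fin n) (Fin n) ℂ}, IsSelfAdjoint S → IsSelfAdjoint S⁻¹ := by
    intro S hS
    exact IsHermitian.inv hS
  have hSS := psqrt_mul_self hA0
  have hSS' := psqrt_mul_self hA0'
  have hS : IsSelfAdjoint (psqrt A) := IsSelfAdjoint.of_nonneg (psqrt_nonneg A)
  have hS' : IsSelfAdjoint (psqrt A') := IsSelfAdjoint.of_nonneg (psqrt_nonneg A')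
  have hT := psqrt_nonneg ((psqrt A)⁻¹ * B * (psqrt A)⁻¹)
  have hTT := psqrt_mul_self (nn (hinv hS) hB)
  have hu : IsUnit (psqrt A).det := by
    have : IsUnit A.det := (Matrix.isUnit_iff_isUnit_det A).1 hA.isUnit
    rw [← hSS, det_mul] at this
    exact isUnit_of_mul_isUnit_left this
  have hu' : IsUnit (psqrt A').det := by
    have : IsUnit A'.det := (Matrix.isUnit_iff_isUnit_det A').1 hA'.isUnit
    rw [← hSS', det_mul] at this
    exact isUnit_of_mul_isUnit_left this
  generalize psqrt ((psqrt A)⁻¹ * B * (psqrt A)⁻¹) = T at *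
  have hi : A⁻¹ = (psqrt A)⁻¹ * (psqrt A)⁻¹ := by rw [← Matrix.mul_inv_rev, hSS]
  have hi' : A'⁻¹ = (psqrt A')⁻¹ * (psqrt A')⁻¹ := by rw [← Matrix.mul_inv_rev, hSS']
  generalize psqrt A = S at *
  generalize psqrt A' = S' at *
  have hX0 : 0 ≤ S * T * S := nn hS hT
  have hXB : (S * T * S) * A⁻¹ * (S * T * S) = B := by
    rw [hi]
    calc _ = S * T * (S * S⁻¹) * (S⁻¹ * S) * T * S := by simp only [Matrix.mul_assoc]
      _ = S * (T * T) * S := by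
        rw [Matrix.mul_nonsing_inv _ hu, Matrix.nonsing_inv_mul _ hu]; simp only [Matrix.mul_assoc, Matrix.mul_one, Matrix.one_mul]
      _ = (S * S⁻¹) * B * (S⁻¹ * S) := by rw [hTT]; simp only [Matrix.mul_assoc]
      _ = B := by rw [Matrix.mul_nonsing_inv _ hu, Matrix.nonsing_inv_mul _ hu]; simp
  generalize S * T * S = X at *
  have hXs : IsSelfAdjoint X := IsSelfAdjoint.of_nonneg hX0
  have key : S'⁻¹ * X * S'⁻¹ ≤ psqrt (S'⁻¹ * B' * S'⁻¹) := by
    refine le_psqrt (nn (hinv hS') hX0) ?_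
    have e : S'⁻¹ * X * S'⁻¹ * (S'⁻¹ * X * S'⁻¹) = S'⁻¹ * (X * A'⁻¹ * X) * S'⁻¹ := by
      rw [hi']; simp only [Matrix.mul_assoc]
    rw [e]
    exact conj (hinv hS') (((conj hXs inv_le).trans_eq hXB).trans hBB)
  have := conj hS' key
  calc X = (S' * S'⁻¹) * X * (S'⁻¹ * S') := by
        rw [Matrix.mul_nonsing_inv _ hu', Matrix.nonsing_inv_mul _ hu']; simp
    _ = S' * (S'⁻¹ * X * S'⁻¹) * S' := by simp only [Matrix.mul_assoc]
    _ ≤ _ := this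

lemma deriv_pos (A B : Matrix (Fin n) (Fin n) ℂ)
    (hA : A.PosDef) (hB : B.PosDef)
    (D : Matrix (Fin n) (Fin n) ℂ × Matrix (Fin n) (Fin n) ℂ →L[ℝ] Matrix (Fin n) (Fin n) ℂ)
    (hD : HasFDerivWithinAt (fun p : Matrix (Fin n) (Fin n) ℂ × Matrix (Fin n) (Fin n) ℂ =>
        gm p.1 p.2) D
      {p : Matrix (Fin n) (Fin n) ℂ × Matrix (Fin n) (Fin n) ℂ |
        p.1.IsHermitian ∧ p.2.IsHermitian} (A, B))
    (X Y : Matrix (Fin n) (Fin n) ℂ) (hX : 0 ≤ X) (hY : 0 ≤ Y) : 0 ≤ D (X, Y) := by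
  have hl : HasDerivWithinAt (fun t : ℝ => (A, B) + t • (X, Y)) (X, Y) (Set.Ioi 0) 0 := by
    have := ((hasDerivAt_id (0:ℝ)).smul_const (X, Y)).const_add (A, B)
    rw [one_smul] at this
    exact this.hasDerivWithinAt
  have hXs : ∀ t : ℝ, 0 < t → 0 ≤ t • X := fun t ht => smul_nonneg ht.le hX
  have hYs : ∀ t : ℝ, 0 < t → 0 ≤ t • Y := fun t ht => smul_nonneg ht.le hY
  have hc := HasFDerivWithinAt.comp_hasDerivWithinAt_of_eq (0:ℝ) hD hl (fun t ht => by
    refine ⟨?_, ?_⟩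
    · exact hA.1.add (Matrix.nonneg_iff_posSemidef.1 (hXs t ht)).1
    · exact hB.1.add (Matrix.nonneg_iff_posSemidef.1 (hYs t ht)).1) (by simp)
  have ht := (hasDerivWithinAt_iff_tendsto_slope' (by simp)).1 hc
  refine ge_of_tendsto ht ?_
  filter_upwards [self_mem_nhdsWithin] with t ht
  have ht : 0 < t := ht
  rw [slope_def_module]
  refine smul_nonneg (by simpa using ht.le) ?_
  simp only [Function.comp, zero_smul, add_zero, sub_nonneg, Prod.fst_add, Prod.snd_add, Prod.smul_fst, Prod.smul_snd]
  exact gm_mono hA hB.posSemidef.nonneg (le_add_of_nonneg_right (hXs t ht)) (le_add_of_nonneg_right (hYs t ht))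

lemma stmt6_aux (hn : 0 < n) (D : Matrix (Fin n) (Fin n) ℂ × Matrix (Fin n) (Fin n) ℂ →L[ℝ] Matrix (Fin n) (Fin n) ℂ)
    (hD : ∀ X Y, 0 ≤ X → 0 ≤ Y → 0 ≤ D (X, Y)) :
    IsGreatest {r : ℝ | ∃ X Y : Matrix (Fin n) (Fin n) ℂ,
        X.IsHermitian ∧ Y.IsHermitian ∧ max ‖X‖ ‖Y‖ ≤ 1 ∧ r = ‖D (X, Y)‖} ‖D (1, 1)‖ := by
  have : Nonempty (Fin n) := ⟨⟨0, hn⟩⟩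
  have h01 : (0 : Matrix (Fin n) (Fin n) ℂ) ≤ 1 := zero_le_one
  constructor
  · refine ⟨1, 1, Matrix.isHermitian_one, Matrix.isHermitian_one, ?_, rfl⟩
    rw [max_self, CStarRing.norm_one]
  · rintro r ⟨X, Y, hX, hY, hXY, rfl⟩
    have b : ∀ {Z : Matrix (Fin n) (Fin n) ℂ}, Z.IsHermitian → ‖Z‖ ≤ 1 → 0 ≤ 1 - Z ∧ 0 ≤ 1 + Z := by
      exact fun hZ h => one_sub_add_nonneg hZ h
    obtain ⟨x1, x2⟩ := b hX ((le_max_left _ _).trans hXY)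
    obtain ⟨y1, y2⟩ := b hY ((le_max_right _ _).trans hXY)
    have d0 := hD 1 1 h01 h01
    have d1 := hD _ _ x1 y1
    have d2 := hD _ _ x2 y2
    have e1 : D (1 - X, 1 - Y) = D (1, 1) - D (X, Y) := by rw [← map_sub]; rfl
    have e2 : D (1 + X, 1 + Y) = D (1, 1) + D (X, Y) := by rw [← map_add]; rfl
    rw [e1] at d1
    rw [e2] at d2
    refine norm_le_of_abs_le d0 ?_ (neg_le_iff_add_nonneg'.2 d2) (sub_nonneg.1 d1)
    have := (IsSelfAdjoint.of_nonneg d2).sub (IsSelfAdjoint.of_nonneg d0)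
    simpa using this
end

/-- the derivative of the geometric mean map is a positive linear map and its
operator norm is attained at the pair of identity matrices. -/
theorem stmt6 {n : ℕ} (hn : 0 < n) (A B : Matrix (Fin n) (Fin n) ℂ)
    (hA : A.PosDef) (hB : B.PosDef)
    (D : Matrix (Fin n) (Fin n) ℂ × Matrix (Fin n) (Fin n) ℂ →L[ℝ] Matrix (Fin n) (Fin n) ℂ)
    (hD : HasFDerivWithinAt (fun p : Matrix (Fin n) (Fin n) ℂ × Matrix (Fin n) (Fin n) ℂ =>
        gm p.1 p.2) D
      {p : Matrix (Fin n) (Fin n) ℂ × Matrix (Fin n) (Fin n) ℂ |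
        p.1.IsHermitian ∧ p.2.IsHermitian} (A, B)) :
    (∀ X Y : Matrix (Fin n) (Fin n) ℂ, X.PosSemidef → Y.PosSemidef → (D (X, Y)).PosSemidef) ∧
    sSup {r : ℝ | ∃ X Y : Matrix (Fin n) (Fin n) ℂ,
        X.IsHermitian ∧ Y.IsHermitian ∧ max ‖X‖ ‖Y‖ ≤ 1 ∧ r = ‖D (X, Y)‖}
      = ‖D (1, 1)‖ := by
  have hp := deriv_pos A B hA hB D hD
  exact ⟨fun X Y hX hY => Matrix.nonneg_iff_posSemidef.1 (hp X Y hX.nonneg hY.nonneg),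
    (stmt6_aux hn D hp).csSup_eq⟩
end

section
/- Under the stated hypotheses, set N = (W*A − P₁Y₂)·(P₁P₂)^{-1} and M₁ = Q·(iY₁)·Q. Then M₁·P₁^{-1} + P₁^{-1}·M₁ = N + N*, and consequently ‖M₁‖ ≤ (‖P₁‖/2)·‖N + N*‖. -/
open Matrix MeasureTheory Real
open scoped Matrix.Norms.L2Operator ComplexOrder

theorem aux_bound {n : ℕ} (hn : 0 < n) (M P Q : Matrix (Fin n) (Fin n) ℂ)
    (hM : Mᴴ = M) (hQ : Q.PosDef) (hQ2 : Q * Q = P) :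
    ‖M‖ ≤ ‖P‖ / 2 * ‖M * P⁻¹ + P⁻¹ * M‖ := by
  have : Nonempty (Fin n) := ⟨⟨0, hn⟩⟩
  have : CompleteSpace (Matrix (Fin n) (Fin n) ℂ) := FiniteDimensional.complete ℂ _
  have hsa : IsSelfAdjoint M := hM
  obtain ⟨k, hk, hkr⟩ := spectrum.exists_nnnorm_eq_spectralRadius M
  rw [hsa.spectralRadius_eq_nnnorm] at hkr
  have hkM : ‖k‖ = ‖M‖ := by
    have : ‖k‖₊ = ‖M‖₊ := by exact_mod_cast hkr
    exact congrArg NNReal.toReal this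
  have hkre : star k = k := by
    rw [hsa.mem_spectrum_eq_re hk]; simp
  have hdet : (algebraMap ℂ (Matrix (Fin n) (Fin n) ℂ) k - M).det = 0 := by
    by_contra h
    exact hk ((Matrix.isUnit_iff_isUnit_det _).2 (isUnit_iff_ne_zero.2 h))
  obtain ⟨v, hv0, hv⟩ := Matrix.exists_mulVec_eq_zero_iff.2 hdet
  have hv' : M *ᵥ v = k • v := by
    rw [Matrix.sub_mulVec, sub_eq_zero] at hv
    rw [← hv, Algebra.algebraMap_eq_smul_one, Matrix.smul_mulVec, Matrix.one_mulVec]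
  let V : Matrix (Fin n) (Fin n) ℂ := Matrix.of fun i _ => v i
  have hV0 : V ≠ 0 := by
    intro h
    apply hv0
    ext i
    exact congrFun (congrFun h i) ⟨0, hn⟩
  have hMV : M * V = k • V := by
    ext i j
    exact congrFun hv' i
  have hVM : Vᴴ * M = k • Vᴴ := by
    have := congrArg Matrix.conjTranspose hMV
    rwa [Matrix.conjTranspose_mul, Matrix.conjTranspose_smul, hM, hkre] at this
  have hQu : IsUnit Q.det := (Matrix.isUnit_iff_isUnit_det _).1 hQ.isUnit
  have hPi : P⁻¹ = Q⁻¹ * Q⁻¹ := by rw [← hQ2, Matrix.mul_inv_rev]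
  have hQH : Qᴴ = Q := hQ.1
  have hQiH : (Q⁻¹)ᴴ = Q⁻¹ := by rw [Matrix.conjTranspose_nonsing_inv, hQH]
  let Z := Q⁻¹ * V
  have hVZ : V = Q * Z := (Matrix.mul_nonsing_inv_cancel_left _ _ hQu).symm
  have hZ0 : Z ≠ 0 := by
    intro h
    rw [h, Matrix.mul_zero] at hVZ
    exact hV0 hVZ
  have hZZ : Zᴴ * Z = Vᴴ * P⁻¹ * V := by
    simp only [Z, Matrix.conjTranspose_mul, hQiH, hPi, Matrix.mul_assoc]
  have key : Vᴴ * (M * P⁻¹ + P⁻¹ * M) * V = (2 * k) • (Zᴴ * Z) := by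
    have h1 : Vᴴ * (M * P⁻¹ + P⁻¹ * M) * V
        = (Vᴴ * M) * P⁻¹ * V + Vᴴ * P⁻¹ * (M * V) := by noncomm_ring
    rw [h1, hMV, hVM, hZZ, Matrix.smul_mul, Matrix.smul_mul, Matrix.mul_smul, two_mul, add_smul]
  have hPn : ‖P‖ = ‖Q‖ * ‖Q‖ := by
    rw [← hQ2, ← Matrix.l2_opNorm_conjTranspose_mul_self, hQH]
  have h1 : 2 * ‖k‖ * (‖Z‖ * ‖Z‖) ≤ ‖V‖ * ‖M * P⁻¹ + P⁻¹ * M‖ * ‖V‖ := by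
    have := congrArg norm key
    rw [norm_smul, Matrix.l2_opNorm_conjTranspose_mul_self, norm_mul (2 : ℂ) k, Complex.norm_two] at this
    rw [← this]
    refine (norm_mul_le _ _).trans ?_
    gcongr
    refine (norm_mul_le _ _).trans ?_
    rw [Matrix.l2_opNorm_conjTranspose]
  have h2 : ‖V‖ ≤ ‖Q‖ * ‖Z‖ := by
    conv_lhs => rw [hVZ]
    exact norm_mul_le _ _
  have hZp : 0 < ‖Z‖ * ‖Z‖ := by
    have := norm_pos_iff.2 hZ0
    positivity
  have h3 : 2 * ‖k‖ * (‖Z‖ * ‖Z‖) ≤ (‖P‖ * ‖M * P⁻¹ + P⁻¹ * M‖) * (‖Z‖ * ‖Z‖) := by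
    refine h1.trans ?_
    calc _ ≤ (‖Q‖ * ‖Z‖) * ‖M * P⁻¹ + P⁻¹ * M‖ * (‖Q‖ * ‖Z‖) := by gcongr
      _ = _ := by rw [hPn]; ring
  have h4 := le_of_mul_le_mul_right h3 hZp
  rw [hkM] at h4
  linarith

/-- with `N = (W*A − P₁Y₂)(P₁P₂)⁻¹` and `M₁ = Q(iY₁)Q` one has
`M₁ P₁⁻¹ + P₁⁻¹ M₁ = N + N*` and `‖M₁‖ ≤ (‖P₁‖/2) ‖N + N*‖`. -/
theorem stmt10 {n : ℕ} (hn : 0 < n)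
    (W P₁ Q P₂ X Y₁ Y₂ A : Matrix (Fin n) (Fin n) ℂ)
    (hW : W ∈ Matrix.unitaryGroup (Fin n) ℂ)
    (hP₁ : P₁.PosDef) (hcirc : mconj P₁ * P₁ = 1)
    (hQ : Q.PosDef) (hQ2 : Q * Q = P₁)
    (hP₂ : P₂.PosDef) (hP₂r : ∀ i j, (P₂ i j).im = 0)
    (hX : Xᴴ = -X)
    (hY₁r : ∀ i j, (Y₁ i j).im = 0) (hY₁ : Y₁ᵀ = -Y₁)
    (hY₂r : ∀ i j, (Y₂ i j).im = 0) (hY₂ : Y₂ᵀ = Y₂)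
    (hA : A = W * X * P₁ * P₂ + W * Q * (Complex.I • Y₁) * Q * P₂ + W * P₁ * Y₂)
    (N M₁ : Matrix (Fin n) (Fin n) ℂ)
    (hN : N = (Wᴴ * A - P₁ * Y₂) * (P₁ * P₂)⁻¹)
    (hM₁ : M₁ = Q * (Complex.I • Y₁) * Q) :
    M₁ * P₁⁻¹ + P₁⁻¹ * M₁ = N + Nᴴ ∧ ‖M₁‖ ≤ ‖P₁‖ / 2 * ‖N + Nᴴ‖ := by
  have hP₁u : IsUnit P₁.det := (Matrix.isUnit_iff_isUnit_det _).1 hP₁.isUnit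
  have hP₂u : IsUnit P₂.det := (Matrix.isUnit_iff_isUnit_det _).1 hP₂.isUnit
  have hQH : Qᴴ = Q := hQ.1
  have hP₁H : P₁ᴴ = P₁ := hP₁.1
  have hWW : Wᴴ * W = 1 := Matrix.mem_unitaryGroup_iff'.1 hW
  have hYH : (Complex.I • Y₁)ᴴ = Complex.I • Y₁ := by
    ext i j
    have h1 : Y₁ j i = - Y₁ i j := congrFun (congrFun hY₁ i) j
    have h2 : (starRingEnd ℂ) (Y₁ i j) = Y₁ i j := Complex.conj_eq_iff_im.2 (hY₁r i j)
    simp [Matrix.conjTranspose_apply, h1, h2]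
  have hMH : M₁ᴴ = M₁ := by
    rw [hM₁, Matrix.conjTranspose_mul, Matrix.conjTranspose_mul, hYH, hQH, Matrix.mul_assoc]
  have hNe : N = X + M₁ * P₁⁻¹ := by
    have h1 : Wᴴ * A - P₁ * Y₂ = (X * P₁ + M₁) * P₂ := by
      have : Wᴴ * A = (Wᴴ * W) * (X * P₁ * P₂ + Q * (Complex.I • Y₁) * Q * P₂ + P₁ * Y₂) := by
        rw [hA]; simp only [Matrix.mul_assoc, Matrix.mul_add]
      rw [this, hWW, hM₁, Matrix.one_mul, add_sub_cancel_right, Matrix.add_mul]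
    rw [hN, h1, Matrix.mul_inv_rev, ← Matrix.mul_assoc,
      Matrix.mul_nonsing_inv_cancel_right _ _ hP₂u, Matrix.add_mul,
      Matrix.mul_nonsing_inv_cancel_right _ _ hP₁u]
  have hNN : M₁ * P₁⁻¹ + P₁⁻¹ * M₁ = N + Nᴴ := by
    rw [hNe, Matrix.conjTranspose_add, hX, Matrix.conjTranspose_mul, hMH,
      Matrix.conjTranspose_nonsing_inv, hP₁H]
    abel
  refine ⟨hNN, ?_⟩
  rw [← hNN]
  exact aux_bound hn M₁ P₁ Q hMH hQ hQ2
end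

section
/- Let Z be an n×n invertible complex matrix. Define ρ₁(Z) = (ρ₂(Z)^{-1}·(Z*Z)·ρ₂(Z)^{-1})^{1/2}, and set P₁ = ρ₁(Z), P₂ = ρ₂(Z). If D is the (real) Fréchet derivative of ρ₁ at Z, then for every n×n complex matrix A: ‖D(A)‖ ≤ ‖P₁‖²·‖P₂^{-1}‖·(1 + ‖P₁‖·β(Z)·cond(Z)·(1 + cond(Z)⁴))·‖A‖. -/
open Matrix MeasureTheory Real
open scoped Matrix.Norms.L2Operator ComplexOrder

-- ρ₂(Z) = (Z*Z # conj(Z*Z))^{1/2}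
noncomputable def rho2 {n : ℕ} (Z : Matrix (Fin n) (Fin n) ℂ) : Matrix (Fin n) (Fin n) ℂ :=
  psqrt (gm (Zᴴ * Z) (mconj (Zᴴ * Z)))

-- C_Z = (Z*Z)⁻¹ (Z*Z # conj(Z*Z))
noncomputable def CZ {n : ℕ} (Z : Matrix (Fin n) (Fin n) ℂ) : Matrix (Fin n) (Fin n) ℂ :=
  (Zᴴ * Z)⁻¹ * gm (Zᴴ * Z) (mconj (Zᴴ * Z))

-- β(Z) = ∫₀^∞ ‖exp(-t C_Z)‖² dt
noncomputable def beta {n : ℕ} (Z : Matrix (Fin n) (Fin n) ℂ) : ℝ :=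
  ∫ t in Set.Ioi (0 : ℝ), ‖NormedSpace.exp ((-t) • CZ Z)‖ ^ 2

-- cond(Z) = ‖Z‖ ‖Z⁻¹‖
noncomputable def condNum {n : ℕ} (Z : Matrix (Fin n) (Fin n) ℂ) : ℝ := ‖Z‖ * ‖Z⁻¹‖

-- ρ₁(Z) = (ρ₂(Z)⁻¹ (Z*Z) ρ₂(Z)⁻¹)^{1/2}
noncomputable def rho1 {n : ℕ} (Z : Matrix (Fin n) (Fin n) ℂ) : Matrix (Fin n) (Fin n) ℂ :=
  psqrt ((rho2 Z)⁻¹ * (Zᴴ * Z) * (rho2 Z)⁻¹)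

section helpers
open scoped MatrixOrder Topology
open Filter

local notation "Mat" n => Matrix (Fin n) (Fin n) ℂ

variable {n : ℕ}

lemma psqrt_posSemidef {M : Mat n} (hM : M.PosSemidef) : (psqrt M).PosSemidef := by
  rw [psqrt, dif_pos hM]
  have h : (diagonal (((↑) : ℝ → ℂ) ∘ Real.sqrt ∘ hM.1.eigenvalues)).PosSemidef := by
    rw [posSemidef_diagonal_iff]
    intro i
    simp [Real.sqrt_nonneg]
  exact h.mul_mul_conjTranspose_same _

lemma psqrt_mul_self_s15 {M : Mat n} (hM : M.PosSemidef) : psqrt M * psqrt M = M := by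
  rw [psqrt, dif_pos hM]
  have hU : (star hM.1.eigenvectorUnitary : Mat n) * hM.1.eigenvectorUnitary.1 = 1 := by
    simp
  have h2 := hM.1.spectral_theorem
  have hd : diagonal (((↑) : ℝ → ℂ) ∘ Real.sqrt ∘ hM.1.eigenvalues) *
      diagonal (((↑) : ℝ → ℂ) ∘ Real.sqrt ∘ hM.1.eigenvalues) = diagonal (((↑) : ℝ → ℂ) ∘ hM.1.eigenvalues) := by
    rw [diagonal_mul_diagonal]
    congr 1
    ext i
    simp only [Function.comp]
    rw [← Complex.ofReal_mul, Real.mul_self_sqrt (hM.eigenvalues_nonneg i)]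
  conv_rhs => rw [h2]
  rw [Unitary.conjStarAlgAut_apply]
  calc _ = hM.1.eigenvectorUnitary.1 * diagonal (((↑) : ℝ → ℂ) ∘ Real.sqrt ∘ hM.1.eigenvalues) *
      ((star hM.1.eigenvectorUnitary : Mat n) * hM.1.eigenvectorUnitary.1) *
      diagonal (((↑) : ℝ → ℂ) ∘ Real.sqrt ∘ hM.1.eigenvalues) *
      (star hM.1.eigenvectorUnitary : Mat n) := by simp only [Matrix.mul_assoc]
    _ = hM.1.eigenvectorUnitary.1 * (diagonal (((↑) : ℝ → ℂ) ∘ Real.sqrt ∘ hM.1.eigenvalues) *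
      diagonal (((↑) : ℝ → ℂ) ∘ Real.sqrt ∘ hM.1.eigenvalues)) *
      (star hM.1.eigenvectorUnitary : Mat n) := by rw [hU, Matrix.mul_one]; simp only [Matrix.mul_assoc]
    _ = _ := by rw [hd]; rfl

lemma psqrt_eq_sqrt {M : Mat n} (hM : M.PosSemidef) : psqrt M = CFC.sqrt M :=
  (CFC.sqrt_unique (psqrt_mul_self_s15 hM) (nonneg_iff_posSemidef.2 (psqrt_posSemidef hM))).symm

lemma psqrt_unique {M X : Mat n} (hX : X.PosSemidef) (h : X * X = M) : psqrt M = X := by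
  have hM : M.PosSemidef := by
    have := posSemidef_conjTranspose_mul_self X
    rwa [hX.1.eq, h] at this
  rw [psqrt_eq_sqrt hM]
  exact CFC.sqrt_unique h (nonneg_iff_posSemidef.2 hX)

lemma posDef_of_mul_self {M X : Mat n} (hM : M.PosDef) (hX : X.PosSemidef) (h : X * X = M) :
    X.PosDef := by
  rw [hX.posDef_iff_isUnit]
  have h1 := hM.isUnit
  rw [← h] at h1
  exact isUnit_of_mul_isUnit_left h1

lemma psqrt_posDef {M : Mat n} (hM : M.PosDef) : (psqrt M).PosDef :=
  posDef_of_mul_self hM (psqrt_posSemidef hM.posSemidef) (psqrt_mul_self_s15 hM.posSemidef)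

lemma psqrt_continuousOn : ContinuousOn (psqrt (n := n)) {M | M.PosSemidef} := by
  have : ContinuousOn (fun M : Mat n => CFC.sqrt M) {M | M.PosSemidef} := by
    apply ContinuousOn.cfcₙ_nnreal_of_mem_nhdsSet (s := Set.univ) NNReal.sqrt (by simp) continuousOn_id
  exact this.congr fun M hM => psqrt_eq_sqrt hM

/-- exponential decay -/
lemma norm_exp_le {P : Mat n} (hP : P.PosDef) {t : ℝ} (ht : 0 ≤ t) :
    ‖NormedSpace.exp ((-t) • P)‖ ≤ Real.exp (-(t / ‖P⁻¹‖)) := by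
  set U := hP.1.eigenvectorUnitary with hU
  set l := hP.1.eigenvalues with hl
  have hUU : U.1 * star U.1 = 1 := by simp
  have hUU' : star U.1 * U.1 = 1 := by simp
  have hUi : U.1⁻¹ = star U.1 := Matrix.inv_eq_right_inv hUU
  have hUu : IsUnit U.1 := by
    rw [Matrix.isUnit_iff_isUnit_det]
    exact Matrix.isUnit_det_of_right_inverse hUU
  have hlp : ∀ i, 0 < l i := hP.eigenvalues_pos
  have hspec : P = U.1 * diagonal (fun i => (l i : ℂ)) * star U.1 := by
    have h2 := hP.1.spectral_theorem
    rw [Unitary.conjStarAlgAut_apply] at h2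
    exact h2
  have hnorm : ∀ d : Fin n → ℂ, ‖U.1 * diagonal d * star U.1‖ = ‖d‖ := by
    intro d
    rw [← l2_opNorm_diagonal, ← Unitary.coe_star, CStarRing.norm_mul_coe_unitary,
      CStarRing.norm_coe_unitary_mul]
  have hinv : P⁻¹ = U.1 * diagonal (fun i => ((l i)⁻¹ : ℂ)) * star U.1 := by
    apply Matrix.inv_eq_right_inv
    rw [hspec]
    calc _ = U.1 * (diagonal (fun i => (l i : ℂ)) * (star U.1 * U.1) *
          diagonal (fun i => ((l i)⁻¹ : ℂ))) * star U.1 := by simp only [Matrix.mul_assoc]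
      _ = 1 := by
        rw [hUU', Matrix.mul_one, diagonal_mul_diagonal]
        have : (fun i => (l i : ℂ) * ((l i)⁻¹ : ℂ)) = fun _ => 1 := by
          funext i
          have := (hlp i).ne'
          rw [mul_inv_cancel₀]; exact_mod_cast this
        rw [this, diagonal_one, Matrix.mul_one, hUU]
  have hle : ∀ i, (l i)⁻¹ ≤ ‖P⁻¹‖ := by
    intro i
    rw [hinv, hnorm]
    refine le_trans ?_ (norm_le_pi_norm _ i)
    simp [abs_of_pos (hlp i)]
  have hexp : NormedSpace.exp ((-t) • P) =
      U.1 * diagonal (fun i => ((Real.exp (-t * l i) : ℝ) : ℂ)) * star U.1 := by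
    have h3 : (-t) • P = U.1 * diagonal (fun i => ((-t * l i : ℝ) : ℂ)) * U.1⁻¹ := by
      rw [hUi]
      nth_rewrite 1 [hspec]
      rw [← Matrix.smul_mul, ← Matrix.mul_smul, ← diagonal_smul]
      congr 3
      ext i
      simp
    rw [h3, exp_conj _ _ hUu, exp_diagonal, hUi]
    congr 3
    ext i
    rw [Pi.coe_exp, Complex.ofReal_exp, Complex.exp_eq_exp_ℂ]
  rw [hexp, hnorm, pi_norm_le_iff_of_nonneg (Real.exp_pos _).le]
  intro i
  rw [Complex.norm_real, Real.norm_eq_abs, Real.abs_exp, Real.exp_le_exp]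
  have h4 : ‖P⁻¹‖⁻¹ ≤ l i := inv_le_of_inv_le₀ (hlp i) (hle i)
  rw [div_eq_mul_inv]
  nlinarith

lemma mconj_mconj (M : Mat n) : mconj (mconj M) = M := by
  ext i j; simp [mconj]

lemma mconj_mul (M N : Mat n) : mconj (M * N) = mconj M * mconj N := by
  simp [mconj, conjTranspose_mul, transpose_mul]

lemma mconj_add (M N : Mat n) : mconj (M + N) = mconj M + mconj N := by
  simp [mconj]

lemma mconj_inv (M : Mat n) : mconj M⁻¹ = (mconj M)⁻¹ := by
  simp [mconj, conjTranspose_nonsing_inv, transpose_nonsing_inv]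

lemma mconj_posSemidef {M : Mat n} (h : M.PosSemidef) : (mconj M).PosSemidef :=
  h.conjTranspose.transpose

lemma mconj_posDef {M : Mat n} (h : M.PosDef) : (mconj M).PosDef :=
  h.conjTranspose.transpose

lemma norm_mconj_le (M : Mat n) : ‖mconj M‖ ≤ ‖M‖ := by
  rw [cstar_norm_def]
  refine ContinuousLinearMap.opNorm_le_bound _ (norm_nonneg _) fun x => ?_
  have hs : ∀ v : Fin n → ℂ, ‖(WithLp.toLp 2 (star v) : EuclideanSpace ℂ (Fin n))‖ =
      ‖(WithLp.toLp 2 v : EuclideanSpace ℂ (Fin n))‖ := by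
    intro v
    simp [EuclideanSpace.norm_eq]
  have h1 : (mconj M) *ᵥ x.ofLp = star (M *ᵥ star x.ofLp) := by
    rw [star_mulVec, star_star, mconj, mulVec_transpose]
  have h2 := l2_opNorm_mulVec M (WithLp.toLp 2 (star x.ofLp))
  rw [hs] at h2
  have h3 : toEuclideanCLM (n := Fin n) (𝕜 := ℂ) (mconj M) x
    = WithLp.toLp 2 (star (M *ᵥ star x.ofLp)) := by
    rw [← h1]; rfl
  rw [h3, hs]
  exact h2

lemma norm_mconj (M : Mat n) : ‖mconj M‖ = ‖M‖ :=
  le_antisymm (norm_mconj_le M) (by simpa [mconj_mconj] using norm_mconj_le (mconj M))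

lemma lyap_s15 {B E F : Mat n} (h : Bᴴ * E + E * B = F)
    (hi : IntegrableOn (fun t : ℝ => ‖NormedSpace.exp ((-t) • B)‖ ^ 2) (Set.Ioi 0))
    (ht : Tendsto (fun t : ℝ => NormedSpace.exp ((-t) • B)) atTop (𝓝 0)) :
    ‖E‖ ≤ (∫ t in Set.Ioi (0:ℝ), ‖NormedSpace.exp ((-t) • B)‖ ^ 2) * ‖F‖ := by
  set e : ℝ → Mat n := fun t => NormedSpace.exp ((-t) • B) with he
  have hst : ∀ t, (e t)ᴴ = NormedSpace.exp ((-t) • Bᴴ) := by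
    intro t
    rw [he]
    simp only
    rw [← exp_conjTranspose, conjTranspose_smul]
    simp
  have hd1 : ∀ t, HasDerivAt e (-(B * e t)) t := by
    intro t
    have := (hasDerivAt_exp_smul_const' (𝕂 := ℝ) B (-t)).scomp t (hasDerivAt_neg t)
    simpa [Function.comp_def, he] using this
  have hd2 : ∀ t, HasDerivAt (fun t => (e t)ᴴ) (-((e t)ᴴ * Bᴴ)) t := by
    intro t
    have := (hasDerivAt_exp_smul_const (𝕂 := ℝ) Bᴴ (-t)).scomp t (hasDerivAt_neg t)
    simp only [hst]
    simpa [Function.comp_def] using this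
  have hd : ∀ t, HasDerivAt (fun t => (e t)ᴴ * E * e t) (-((e t)ᴴ * F * e t)) t := by
    intro t
    refine (((hd2 t).mul_const E).mul (hd1 t)).congr_deriv ?_
    rw [← h]; noncomm_ring
  have hc : Continuous e := continuous_iff_continuousAt.2 fun t => (hd1 t).continuousAt
  have hcs : Continuous fun t => (e t)ᴴ := continuous_iff_continuousAt.2 fun t => (hd2 t).continuousAt
  have hle : ∀ t, ‖-((e t)ᴴ * F * e t)‖ ≤ ‖e t‖ ^ 2 * ‖F‖ := by
    intro t
    rw [norm_neg]
    calc _ ≤ ‖(e t)ᴴ‖ * ‖F‖ * ‖e t‖ := norm_mul₃_le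
      _ = _ := by rw [l2_opNorm_conjTranspose]; ring
  have hint : IntegrableOn (fun t => -((e t)ᴴ * F * e t)) (Set.Ioi 0) := by
    refine Integrable.mono' (hi.mul_const ‖F‖) ?_ (ae_of_all _ hle)
    exact (((hcs.mul continuous_const).mul hc).neg).aestronglyMeasurable
  have hts : Tendsto (fun t => (e t)ᴴ * E * e t) atTop (𝓝 0) := by
    have : Tendsto (fun t => (e t)ᴴ) atTop (𝓝 0) := by
      rw [tendsto_zero_iff_norm_tendsto_zero] at ht ⊢
      simpa [l2_opNorm_conjTranspose] using ht
    simpa using (this.mul_const E).mul ht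
  have key := integral_Ioi_of_hasDerivAt_of_tendsto' (a := 0) (fun t _ => hd t) hint hts
  have he0 : e 0 = 1 := by simp [he]
  rw [he0] at key
  simp only [conjTranspose_one, one_mul, mul_one, zero_sub] at key
  calc ‖E‖ = ‖-E‖ := (norm_neg _).symm
    _ = ‖∫ t in Set.Ioi (0:ℝ), -((e t)ᴴ * F * e t)‖ := by rw [key]
    _ ≤ ∫ t in Set.Ioi (0:ℝ), ‖e t‖ ^ 2 * ‖F‖ :=
      norm_integral_le_of_norm_le (hi.mul_const ‖F‖) (ae_of_all _ hle)
    _ = _ := by rw [integral_mul_const]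

lemma decay {B : Mat n} {c a : ℝ} (ha : 0 < a)
    (h : ∀ t : ℝ, 0 ≤ t → ‖NormedSpace.exp ((-t) • B)‖ ≤ c * Real.exp (-a * t)) :
    IntegrableOn (fun t : ℝ => ‖NormedSpace.exp ((-t) • B)‖ ^ 2) (Set.Ioi 0) ∧
    Tendsto (fun t : ℝ => NormedSpace.exp ((-t) • B)) atTop (𝓝 0) := by
  have hc : Continuous (fun t : ℝ => NormedSpace.exp ((-t) • B)) := by
    have := (differentiable_exp_smul_const ℝ B).continuous
    exact this.comp continuous_neg
  constructor
  · have hi : IntegrableOn (fun t : ℝ => c ^ 2 * Real.exp (-(2 * a) * t)) (Set.Ioi 0) :=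
      (integrableOn_exp_mul_Ioi (by linarith) 0).const_mul _
    refine Integrable.mono' hi (hc.norm.pow 2).aestronglyMeasurable ?_
    refine (ae_restrict_iff' measurableSet_Ioi).2 (ae_of_all _ fun t ht => ?_)
    rw [Real.norm_eq_abs, abs_of_nonneg (by positivity)]
    have := pow_le_pow_left₀ (norm_nonneg _) (h t (le_of_lt ht)) 2
    refine this.trans (le_of_eq ?_)
    rw [mul_pow, ← Real.exp_nat_mul]
    congr 2
    push_cast; ring
  · rw [tendsto_zero_iff_norm_tendsto_zero]
    have h0 : Tendsto (fun t : ℝ => c * Real.exp (-a * t)) atTop (𝓝 0) := by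
      have : Tendsto (fun t : ℝ => Real.exp (-a * t)) atTop (𝓝 0) := by
        apply Real.tendsto_exp_atBot.comp
        exact tendsto_id.const_mul_atTop_of_neg (by linarith)
      simpa using this.const_mul c
    refine squeeze_zero' (Eventually.of_forall fun _ => norm_nonneg _) ?_ h0
    filter_upwards [eventually_ge_atTop 0] with t ht using h t ht

lemma sylv {P : Mat n} (hP : P.PosDef) (E : Mat n) :
    ‖E‖ ≤ ‖P⁻¹‖ / 2 * ‖P * E + E * P‖ := by
  have hu := hP.isUnit
  rw [Matrix.isUnit_iff_isUnit_det] at hu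
  rcases (norm_nonneg P⁻¹).eq_or_lt with h0 | h0
  · have h1 : P⁻¹ = 0 := norm_eq_zero.1 h0.symm
    have h2 : E = P⁻¹ * P * E := by rw [nonsing_inv_mul _ hu, one_mul]
    rw [h1] at h2
    simp only [zero_mul] at h2
    rw [h2]; simp
  have hb : ∀ t : ℝ, 0 ≤ t → ‖NormedSpace.exp ((-t) • P)‖ ≤ 1 * Real.exp (-‖P⁻¹‖⁻¹ * t) := by
    intro t ht
    refine (norm_exp_le hP ht).trans (le_of_eq ?_)
    rw [one_mul]; congr 1; field_simp
  obtain ⟨h1, h2⟩ := decay (inv_pos.2 h0) hb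
  have h3 := lyap_s15 (B := P) (E := E) (F := P * E + E * P) (by rw [hP.1.eq]) h1 h2
  refine h3.trans (mul_le_mul_of_nonneg_right ?_ (norm_nonneg _))
  have hneg : -(2 * ‖P⁻¹‖⁻¹) < 0 := by have := inv_pos.2 h0; linarith
  calc _ ≤ ∫ t in Set.Ioi (0:ℝ), Real.exp (-(2 * ‖P⁻¹‖⁻¹) * t) := by
        refine setIntegral_mono_on h1 (integrableOn_exp_mul_Ioi hneg 0) measurableSet_Ioi ?_
        intro t ht
        have := pow_le_pow_left₀ (norm_nonneg _) (hb t (le_of_lt ht)) 2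
        refine this.trans (le_of_eq ?_)
        rw [one_mul, ← Real.exp_nat_mul]
        congr 1
        push_cast; ring
    _ = _ := by
        rw [integral_exp_mul_Ioi hneg]
        simp
        ring

lemma decay_sim {S K C : Mat n} (hS : IsUnit S) (hK : K.PosDef) (hC : C = S * K * S⁻¹) :
    IntegrableOn (fun t : ℝ => ‖NormedSpace.exp ((-t) • C)‖ ^ 2) (Set.Ioi 0) ∧
    Tendsto (fun t : ℝ => NormedSpace.exp ((-t) • C)) atTop (𝓝 0) := by
  have hu := hK.isUnit
  rw [Matrix.isUnit_iff_isUnit_det] at hu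
  have key : ∀ t : ℝ, 0 ≤ t → ‖NormedSpace.exp ((-t) • C)‖ ≤
      ‖S‖ * ‖S⁻¹‖ * Real.exp (-(t / ‖K⁻¹‖)) := by
    intro t ht
    have : (-t) • C = S * ((-t) • K) * S⁻¹ := by
      rw [hC, Matrix.mul_smul, Matrix.smul_mul]
    rw [this, exp_conj _ _ hS]
    calc _ ≤ ‖S‖ * ‖NormedSpace.exp ((-t) • K)‖ * ‖S⁻¹‖ := norm_mul₃_le
      _ ≤ ‖S‖ * Real.exp (-(t / ‖K⁻¹‖)) * ‖S⁻¹‖ := by gcongr; exact norm_exp_le hK ht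
      _ = _ := by ring
  rcases (norm_nonneg K⁻¹).eq_or_lt with h0 | h0
  · have h1 : K⁻¹ = 0 := norm_eq_zero.1 h0.symm
    have h2 : ∀ X : Mat n, X = 0 := fun X => by
      have : X = K⁻¹ * K * X := by rw [nonsing_inv_mul _ hu, one_mul]
      rw [h1] at this
      simpa using this
    have h3 : (fun t : ℝ => NormedSpace.exp ((-t) • C)) = fun _ => 0 := by
      funext t; exact h2 _
    refine ⟨?_, by rw [h3]; exact tendsto_const_nhds⟩
    have h4 : (fun t : ℝ => ‖NormedSpace.exp ((-t) • C)‖ ^ 2) = fun _ => 0 := by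
      funext t; rw [h2 (NormedSpace.exp ((-t) • C))]; simp
    rw [h4]; exact integrableOn_zero
  · refine decay (c := ‖S‖ * ‖S⁻¹‖) (inv_pos.2 h0) fun t ht => (key t ht).trans (le_of_eq ?_)
    congr 2; field_simp

lemma psqrt_diff {M : ℝ → Mat n} (hM : DifferentiableAt ℝ M 0)
    (hp : ∀ᶠ t in 𝓝 0, (M t).PosDef) : DifferentiableAt ℝ (fun t => psqrt (M t)) 0 := by
  have hp0 := hp.self_of_nhds
  set P := psqrt (M 0) with hPdef
  have hP : P.PosDef := psqrt_posDef hp0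
  have hcont : ContinuousAt (fun t => psqrt (M t)) 0 := by
    have h1 := psqrt_continuousOn (n := n) (M 0) hp0.posSemidef
    have h2 : Tendsto M (𝓝 0) (𝓝[{M | M.PosSemidef}] (M 0)) :=
      tendsto_nhdsWithin_iff.2 ⟨hM.continuousAt, hp.mono fun t ht => ht.posSemidef⟩
    exact Tendsto.comp h1 h2
  have hf := (hasStrictFDerivAt_id (𝕜 := ℝ) P).mul' (hasStrictFDerivAt_id (𝕜 := ℝ) P)
  obtain ⟨L, hL⟩ : ∃ L : (Mat n) →L[ℝ] (Mat n), L = id P • ContinuousLinearMap.id ℝ (Mat n) +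
    MulOpposite.op (id P) • ContinuousLinearMap.id ℝ (Mat n) := ⟨_, rfl⟩
  rw [← hL] at hf
  have hLa : ∀ Y, L Y = P * Y + Y * P := by
    intro Y
    rw [hL]
    simp
  have hinj : Function.Injective L.toLinearMap := by
    rw [← LinearMap.ker_eq_bot, LinearMap.ker_eq_bot']
    intro Y hY
    have h1 := sylv hP Y
    have h2 : P * Y + Y * P = 0 := by rw [← hLa]; exact hY
    rw [h2, norm_zero, mul_zero] at h1
    exact norm_le_zero_iff.1 h1
  let Le : (Mat n) ≃L[ℝ] (Mat n) :=
    (LinearEquiv.ofInjectiveEndo L.toLinearMap hinj).toContinuousLinearEquiv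
  have hLe : (Le : (Mat n) →L[ℝ] (Mat n)) = L := by
    ext1 Y
    rfl
  rw [← hLe] at hf
  have hinv := hf.to_localInverse
  have hleft := hf.eventually_left_inverse
  have hPP : (id * id : (Mat n) → (Mat n)) P = M 0 := psqrt_mul_self_s15 hp0.posSemidef
  rw [hPP] at hinv
  have hd : DifferentiableAt ℝ (fun t => hf.localInverse _ _ _ (M t)) 0 :=
    DifferentiableAt.comp (0 : ℝ) hinv.hasFDerivAt.differentiableAt hM
  refine hd.congr_of_eventuallyEq ?_
  have h5 := hcont.eventually hleft
  filter_upwards [h5, hp] with t ht hpt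
  have h6 : (id * id : (Mat n) → (Mat n)) (psqrt (M t)) = M t := psqrt_mul_self_s15 hpt.posSemidef
  rw [h6] at ht
  exact ht.symm


lemma diff_inv {M : ℝ → Mat n} (hM : DifferentiableAt ℝ M 0) (hu : IsUnit (M 0)) :
    DifferentiableAt ℝ (fun t => (M t)⁻¹) 0 := by
  simp only [nonsing_inv_eq_ringInverse]
  obtain ⟨u, hu⟩ := hu
  have h := (hasFDerivAt_ringInverse (𝕜 := ℝ) u).differentiableAt
  rw [hu] at h
  exact DifferentiableAt.comp (0 : ℝ) h hM

lemma posDef_conj {R X : Mat n} (hR : R.PosDef) (hX : X.PosDef) : (R * X * R).PosDef := by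
  have := (Matrix.IsUnit.posDef_star_left_conjugate_iff (x := X) hR.isUnit).2 hX
  rwa [star_eq_conjTranspose, hR.1.eq] at this

lemma posSemidef_conj {R X : Mat n} (hR : R.PosDef) (hX : X.PosSemidef) :
    (R * X * R).PosSemidef := by
  have := hX.conjTranspose_mul_mul_same R
  rwa [hR.1.eq] at this

lemma det_unit {M : Mat n} (h : M.PosDef) : IsUnit M.det :=
  (Matrix.isUnit_iff_isUnit_det M).1 h.isUnit

lemma gm_posDef {H K : Mat n} (hH : H.PosDef) (hK : K.PosDef) : (gm H K).PosDef := by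
  have hR := psqrt_posDef hH
  exact posDef_conj hR (psqrt_posDef (posDef_conj hR.inv hK))

lemma inv_eq_psqrt {H : Mat n} (hH : H.PosDef) : H⁻¹ = (psqrt H)⁻¹ * (psqrt H)⁻¹ := by
  rw [← Matrix.mul_inv_rev, psqrt_mul_self_s15 hH.posSemidef]

lemma gm_riccati {H K : Mat n} (hH : H.PosDef) (hK : K.PosDef) :
    gm H K * H⁻¹ * gm H K = K := by
  have hR := psqrt_posDef hH
  have hu := det_unit hR
  have hW := psqrt_mul_self_s15 (posDef_conj hR.inv hK).posSemidef
  rw [inv_eq_psqrt hH, gm]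
  set R := psqrt H
  set W := psqrt (R⁻¹ * K * R⁻¹)
  calc _ = R * W * (R * R⁻¹) * (R⁻¹ * R) * W * R := by simp only [Matrix.mul_assoc]
    _ = R * (W * W) * R := by
      rw [mul_nonsing_inv _ hu, nonsing_inv_mul _ hu]; simp only [Matrix.mul_assoc, Matrix.one_mul]
    _ = (R * R⁻¹) * K * (R⁻¹ * R) := by rw [hW]; simp only [Matrix.mul_assoc]
    _ = K := by rw [mul_nonsing_inv _ hu, nonsing_inv_mul _ hu, Matrix.one_mul, Matrix.mul_one]

lemma gm_unique {H K X : Mat n} (hH : H.PosDef) (hX : X.PosSemidef)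
    (h : X * H⁻¹ * X = K) : gm H K = X := by
  have hR := psqrt_posDef hH
  have hu := det_unit hR
  have hi := inv_eq_psqrt hH
  rw [gm]
  set R := psqrt H
  have h1 : psqrt (R⁻¹ * K * R⁻¹) = R⁻¹ * X * R⁻¹ := by
    apply psqrt_unique (posSemidef_conj hR.inv hX)
    rw [← h, hi]; simp only [Matrix.mul_assoc]
  rw [h1]
  calc _ = (R * R⁻¹) * X * (R⁻¹ * R) := by simp only [Matrix.mul_assoc]
    _ = X := by rw [mul_nonsing_inv _ hu, nonsing_inv_mul _ hu, Matrix.one_mul, Matrix.mul_one]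

lemma gm_diff {H K : ℝ → Mat n} (hH : DifferentiableAt ℝ H 0) (hK : DifferentiableAt ℝ K 0)
    (pH : ∀ᶠ t in 𝓝 0, (H t).PosDef) (pK : ∀ᶠ t in 𝓝 0, (K t).PosDef) :
    DifferentiableAt ℝ (fun t => gm (H t) (K t)) 0 := by
  have h1 := psqrt_diff hH pH
  have h2 := diff_inv h1 (psqrt_posDef pH.self_of_nhds).isUnit
  have h3 : DifferentiableAt ℝ (fun t => psqrt ((psqrt (H t))⁻¹ * K t * (psqrt (H t))⁻¹)) 0 := by
    apply psqrt_diff ((h2.mul hK).mul h2)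
    filter_upwards [pH, pK] with t h k
    exact posDef_conj (psqrt_posDef h).inv k
  exact (h1.mul h3).mul h1

/-- product rule along an eventual identity -/
lemma prod_rule {f g h : ℝ → Mat n} {f' g' h' : Mat n} (hf : HasDerivAt f f' 0)
    (hg : HasDerivAt g g' 0) (hh : HasDerivAt h h' 0) (e : ∀ᶠ t in 𝓝 0, f t * g t = h t) :
    f' * g 0 + f 0 * g' = h' := by
  have h1 := hf.mul hg
  have h2 : HasDerivAt (fun t => f t * g t) h' 0 := hh.congr_of_eventuallyEq e
  exact h1.unique h2

lemma mconj_hasDerivAt {H : ℝ → Mat n} {h : Mat n} (hH : HasDerivAt H h 0) :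
    HasDerivAt (fun t => mconj (H t)) (mconj h) 0 := by
  let L : (Mat n) →ₗ[ℝ] (Mat n) :=
    { toFun := mconj
      map_add' := mconj_add
      map_smul' := by intro c x; ext i j; simp [mconj] }
  exact (LinearMap.toContinuousLinearMap L).hasFDerivAt.comp_hasDerivAt (0 : ℝ) hH

section atZ
variable {Z : Mat n}

lemma H_posDef (hZ : IsUnit Z) : (Zᴴ * Z).PosDef := by
  have := (Matrix.IsUnit.posDef_star_left_conjugate_iff (x := (1 : Mat n)) hZ).2 PosDef.one
  simpa [star_eq_conjTranspose] using this

lemma rho2_posDef (hZ : IsUnit Z) : (rho2 Z).PosDef :=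
  psqrt_posDef (gm_posDef (H_posDef hZ) (mconj_posDef (H_posDef hZ)))

lemma rho1_posDef (hZ : IsUnit Z) : (rho1 Z).PosDef :=
  psqrt_posDef (posDef_conj (rho2_posDef hZ).inv (H_posDef hZ))

lemma rho1_sq (hZ : IsUnit Z) : rho1 Z * rho1 Z = (rho2 Z)⁻¹ * (Zᴴ * Z) * (rho2 Z)⁻¹ :=
  psqrt_mul_self_s15 (posDef_conj (rho2_posDef hZ).inv (H_posDef hZ)).posSemidef

lemma rho2_sq (hZ : IsUnit Z) : rho2 Z * rho2 Z = gm (Zᴴ * Z) (mconj (Zᴴ * Z)) :=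
  psqrt_mul_self_s15 (gm_posDef (H_posDef hZ) (mconj_posDef (H_posDef hZ))).posSemidef

lemma inv_riccati {G Q K : Mat n} (hG : IsUnit G.det) (h : G * Q * G = K) :
    G⁻¹ * K * G⁻¹ = Q := by
  rw [← h]
  calc _ = (G⁻¹ * G) * Q * (G * G⁻¹) := by simp only [Matrix.mul_assoc]
    _ = Q := by rw [mul_nonsing_inv _ hG, nonsing_inv_mul _ hG, Matrix.one_mul, Matrix.mul_one]

lemma mconj_gm (hZ : IsUnit Z) : mconj (gm (Zᴴ * Z) (mconj (Zᴴ * Z))) =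
    gm (Zᴴ * Z) (mconj (Zᴴ * Z)) := by
  have hH := H_posDef hZ
  set H := Zᴴ * Z
  have hK := mconj_posDef hH
  have hG := gm_posDef hH hK
  have hr := gm_riccati hH hK
  symm
  apply gm_unique hH (mconj_posSemidef hG.posSemidef)
  have h1 := congrArg mconj hr
  rw [mconj_mul, mconj_mul, mconj_mconj, mconj_inv] at h1
  have h2 := inv_riccati (det_unit (mconj_posDef hG)) h1
  have h3 := congrArg (·⁻¹) h2
  simp only [Matrix.mul_inv_rev, nonsing_inv_nonsing_inv _ (det_unit (mconj_posDef hG)),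
    nonsing_inv_nonsing_inv _ (det_unit hK)] at h3
  rw [Matrix.mul_assoc]
  exact h3

lemma mconj_rho2 (hZ : IsUnit Z) : mconj (rho2 Z) = rho2 Z := by
  symm
  refine psqrt_unique (mconj_posSemidef (rho2_posDef hZ).posSemidef) ?_
  rw [← mconj_mul, rho2_sq hZ, mconj_gm hZ]

lemma herm_norm {P : Mat n} (hP : P.IsHermitian) : ‖P * P‖ = ‖P‖ * ‖P‖ := by
  have := l2_opNorm_conjTranspose_mul_self P
  rwa [hP.eq] at this

lemma norm_rho1_inv (hZ : IsUnit Z) : ‖(rho1 Z)⁻¹‖ = ‖rho1 Z‖ := by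
  have hH := H_posDef hZ
  have h1 := rho1_posDef hZ
  have h2 := rho2_posDef hZ
  have hu := det_unit h2
  have hsq := rho1_sq hZ
  have hr := gm_riccati hH (mconj_posDef hH)
  rw [← rho2_sq hZ] at hr
  have hc : mconj (rho1 Z * rho1 Z) = (rho1 Z)⁻¹ * (rho1 Z)⁻¹ := by
    rw [← Matrix.mul_inv_rev, hsq, mconj_mul, mconj_mul, mconj_inv, mconj_rho2 hZ, ← hr]
    simp only [Matrix.mul_inv_rev, nonsing_inv_nonsing_inv _ hu]
    set P := rho2 Z
    calc _ = (P⁻¹ * P) * P * (Z⁻¹ * (Zᴴ)⁻¹) * P * (P * P⁻¹) := by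
          simp only [Matrix.mul_assoc]
      _ = _ := by
        rw [mul_nonsing_inv _ hu, nonsing_inv_mul _ hu]; simp only [Matrix.mul_assoc, Matrix.one_mul, Matrix.mul_one]
  have h3 : ‖(rho1 Z)⁻¹‖ * ‖(rho1 Z)⁻¹‖ = ‖rho1 Z‖ * ‖rho1 Z‖ := by
    rw [← herm_norm h1.inv.1, ← herm_norm h1.1, ← hc, norm_mconj]
  exact (mul_self_inj (norm_nonneg _) (norm_nonneg _)).1 h3

lemma norm_Z_rho2_inv (hZ : IsUnit Z) : ‖Z * (rho2 Z)⁻¹‖ = ‖rho1 Z‖ := by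
  have h2 := (rho2_posDef hZ).inv
  have h := l2_opNorm_conjTranspose_mul_self (Z * (rho2 Z)⁻¹)
  have e : (Z * (rho2 Z)⁻¹)ᴴ * (Z * (rho2 Z)⁻¹) = rho1 Z * rho1 Z := by
    rw [rho1_sq hZ, conjTranspose_mul, h2.1.eq]; simp only [Matrix.mul_assoc]
  rw [e, herm_norm (rho1_posDef hZ).1] at h
  exact (mul_self_inj (norm_nonneg _) (norm_nonneg _)).1 h.symm

lemma norm_gm_le (hZ : IsUnit Z) : ‖gm (Zᴴ * Z) (mconj (Zᴴ * Z))‖ ≤ ‖Z‖ ^ 2 := by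
  have hH := H_posDef hZ
  have hr := gm_riccati hH (mconj_posDef hH)
  have hG := gm_posDef hH (mconj_posDef hH)
  set G := gm (Zᴴ * Z) (mconj (Zᴴ * Z))
  have hz : IsUnit (Zᴴ).det := by
    rw [det_conjTranspose]; exact ((Matrix.isUnit_iff_isUnit_det Z).1 hZ).star
  have h := l2_opNorm_conjTranspose_mul_self ((Zᴴ)⁻¹ * G)
  have e : ((Zᴴ)⁻¹ * G)ᴴ * ((Zᴴ)⁻¹ * G) = mconj (Zᴴ * Z) := by
    rw [← hr, conjTranspose_mul, hG.1.eq, conjTranspose_nonsing_inv, conjTranspose_conjTranspose,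
      Matrix.mul_inv_rev]
    simp only [Matrix.mul_assoc]
  rw [e, norm_mconj, l2_opNorm_conjTranspose_mul_self] at h
  have h' := (mul_self_inj (norm_nonneg _) (norm_nonneg _)).1 h
  calc ‖G‖ = ‖Zᴴ * ((Zᴴ)⁻¹ * G)‖ := by rw [← Matrix.mul_assoc, mul_nonsing_inv _ hz, Matrix.one_mul]
    _ ≤ ‖Zᴴ‖ * ‖(Zᴴ)⁻¹ * G‖ := norm_mul_le _ _
    _ = _ := by rw [l2_opNorm_conjTranspose, ← h']; ring

lemma norm_gm_inv_le (hZ : IsUnit Z) : ‖(gm (Zᴴ * Z) (mconj (Zᴴ * Z)))⁻¹‖ ≤ ‖Z⁻¹‖ ^ 2 := by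
  have hH := H_posDef hZ
  have hr := gm_riccati hH (mconj_posDef hH)
  have hG := gm_posDef hH (mconj_posDef hH)
  set G := gm (Zᴴ * Z) (mconj (Zᴴ * Z))
  have hz : IsUnit Z.det := (Matrix.isUnit_iff_isUnit_det Z).1 hZ
  have h := l2_opNorm_conjTranspose_mul_self (Z * G⁻¹)
  have e : (Z * G⁻¹)ᴴ * (Z * G⁻¹) = mconj (Z⁻¹ * (Z⁻¹)ᴴ) := by
    have h3 := congrArg (·⁻¹) hr
    simp only [Matrix.mul_inv_rev G, Matrix.mul_inv_rev _ G,
      nonsing_inv_nonsing_inv _ (det_unit hH)] at h3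
    rw [conjTranspose_mul, hG.inv.1.eq, conjTranspose_nonsing_inv, ← Matrix.mul_inv_rev, mconj_inv,
      ← h3]
    simp only [Matrix.mul_assoc]
  have h4 := l2_opNorm_conjTranspose_mul_self (Z⁻¹)ᴴ
  rw [conjTranspose_conjTranspose, l2_opNorm_conjTranspose] at h4
  rw [e, norm_mconj, h4] at h
  have h' := (mul_self_inj (norm_nonneg _) (norm_nonneg _)).1 h
  calc ‖G⁻¹‖ = ‖Z⁻¹ * (Z * G⁻¹)‖ := by rw [← Matrix.mul_assoc, nonsing_inv_mul _ hz, Matrix.one_mul]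
    _ ≤ ‖Z⁻¹‖ * ‖Z * G⁻¹‖ := norm_mul_le _ _
    _ = _ := by rw [← h']; ring

lemma norm_rho2_inv_le (hZ : IsUnit Z) : ‖(rho2 Z)⁻¹‖ ≤ ‖Z⁻¹‖ := by
  have h := norm_gm_inv_le hZ
  rw [← rho2_sq hZ, Matrix.mul_inv_rev, herm_norm (rho2_posDef hZ).inv.1, ← sq] at h
  exact (pow_le_pow_iff_left₀ (norm_nonneg _) (norm_nonneg _) two_ne_zero).1 h

lemma norm_CZ_le (hZ : IsUnit Z) : ‖CZ Z‖ ≤ condNum Z ^ 2 := by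
  have h1 : ‖(Zᴴ * Z)⁻¹‖ = ‖Z⁻¹‖ ^ 2 := by
    have h4 := l2_opNorm_conjTranspose_mul_self (Z⁻¹)ᴴ
    rw [conjTranspose_conjTranspose, l2_opNorm_conjTranspose] at h4
    rw [Matrix.mul_inv_rev, ← conjTranspose_nonsing_inv, h4, sq]
  calc ‖CZ Z‖ ≤ ‖(Zᴴ * Z)⁻¹‖ * ‖gm (Zᴴ * Z) (mconj (Zᴴ * Z))‖ := norm_mul_le _ _
    _ ≤ ‖Z⁻¹‖ ^ 2 * ‖Z‖ ^ 2 := by rw [h1]; gcongr; exact norm_gm_le hZ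
    _ = _ := by rw [condNum]; ring

lemma CZ_decay (hZ : IsUnit Z) :
    IntegrableOn (fun t : ℝ => ‖NormedSpace.exp ((-t) • CZ Z)‖ ^ 2) (Set.Ioi 0) ∧
    Tendsto (fun t : ℝ => NormedSpace.exp ((-t) • CZ Z)) atTop (𝓝 0) := by
  have hH := H_posDef hZ
  have hR := psqrt_posDef hH
  have hG := gm_posDef hH (mconj_posDef hH)
  have hu := det_unit hR
  refine decay_sim (S := (psqrt (Zᴴ * Z))⁻¹) hR.inv.isUnit (posDef_conj hR.inv hG) ?_
  rw [CZ, inv_eq_psqrt hH, nonsing_inv_nonsing_inv _ hu]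
  set R := psqrt (Zᴴ * Z)
  simp only [Matrix.mul_assoc]
  rw [nonsing_inv_mul _ hu, Matrix.mul_one]

end atZ

lemma main_bound_s15 {Z : Mat n} (hZ : IsUnit Z) (A dH k g q p v s d : Mat n)
    (e_dH : dH = Aᴴ * Z + Zᴴ * A) (e_k : k = mconj dH)
    (e_q : q * (Zᴴ * Z) + (Zᴴ * Z)⁻¹ * dH = 0)
    (e_g : (g * (Zᴴ * Z)⁻¹ + gm (Zᴴ * Z) (mconj (Zᴴ * Z)) * q) * gm (Zᴴ * Z) (mconj (Zᴴ * Z)) +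
      gm (Zᴴ * Z) (mconj (Zᴴ * Z)) * (Zᴴ * Z)⁻¹ * g = k)
    (e_p : p * rho2 Z + rho2 Z * p = g)
    (e_v : v * rho2 Z + (rho2 Z)⁻¹ * p = 0)
    (e_s : (v * (Zᴴ * Z) + (rho2 Z)⁻¹ * dH) * (rho2 Z)⁻¹ + (rho2 Z)⁻¹ * (Zᴴ * Z) * v = s)
    (e_d : d * rho1 Z + rho1 Z * d = s) :
    ‖d‖ ≤ ‖rho1 Z‖ ^ 2 * ‖(rho2 Z)⁻¹‖ *
        (1 + ‖rho1 Z‖ * beta Z * condNum Z * (1 + condNum Z ^ 4)) * ‖A‖ := by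
  have hH := H_posDef hZ
  have hG := gm_posDef hH (mconj_posDef hH)
  have hP2 := rho2_posDef hZ
  have hP1 := rho1_posDef hZ
  have hHu := det_unit hH
  have hPu := det_unit hP2
  have ndH : ‖dH‖ ≤ 2 * ‖Z‖ * ‖A‖ := by
    rw [e_dH]
    calc _ ≤ ‖Aᴴ * Z‖ + ‖Zᴴ * A‖ := norm_add_le _ _
      _ ≤ ‖Aᴴ‖ * ‖Z‖ + ‖Zᴴ‖ * ‖A‖ := add_le_add (norm_mul_le _ _) (norm_mul_le _ _)
      _ = _ := by rw [l2_opNorm_conjTranspose, l2_opNorm_conjTranspose]; ring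
  have hq : q = -((Zᴴ * Z)⁻¹ * dH * (Zᴴ * Z)⁻¹) := by
    have h1 : q * (Zᴴ * Z) = -((Zᴴ * Z)⁻¹ * dH) := eq_neg_of_add_eq_zero_left e_q
    calc q = q * (Zᴴ * Z) * (Zᴴ * Z)⁻¹ := by
          rw [Matrix.mul_assoc, mul_nonsing_inv _ hHu, Matrix.mul_one]
      _ = _ := by rw [h1, Matrix.neg_mul]
  have hv : v = -((rho2 Z)⁻¹ * p * (rho2 Z)⁻¹) := by
    have h1 : v * rho2 Z = -((rho2 Z)⁻¹ * p) := eq_neg_of_add_eq_zero_left e_v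
    calc v = v * rho2 Z * (rho2 Z)⁻¹ := by
          rw [Matrix.mul_assoc, mul_nonsing_inv _ hPu, Matrix.mul_one]
      _ = _ := by rw [h1, Matrix.neg_mul]
  have hβ : 0 ≤ beta Z := integral_nonneg fun t => by positivity
  have hκ : 0 ≤ condNum Z := mul_nonneg (norm_nonneg _) (norm_nonneg _)
  have hCs : (CZ Z)ᴴ = gm (Zᴴ * Z) (mconj (Zᴴ * Z)) * (Zᴴ * Z)⁻¹ := by
    rw [CZ, conjTranspose_mul, hG.1.eq, hH.inv.1.eq]
  have ng : ‖g‖ ≤ beta Z * ‖k + (CZ Z)ᴴ * dH * CZ Z‖ := by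
    obtain ⟨hi, ht⟩ := CZ_decay hZ
    refine lyap_s15 ?_ hi ht
    rw [← e_g, hq, hCs, CZ]
    noncomm_ring
  have nF : ‖k + (CZ Z)ᴴ * dH * CZ Z‖ ≤ (1 + condNum Z ^ 4) * (2 * ‖Z‖ * ‖A‖) := by
    calc _ ≤ ‖k‖ + ‖(CZ Z)ᴴ * dH * CZ Z‖ := norm_add_le _ _
      _ ≤ ‖dH‖ + ‖(CZ Z)ᴴ‖ * ‖dH‖ * ‖CZ Z‖ := by
        rw [e_k, norm_mconj]; gcongr; exact norm_mul₃_le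
      _ = (1 + ‖CZ Z‖ ^ 2) * ‖dH‖ := by rw [l2_opNorm_conjTranspose]; ring
      _ ≤ (1 + (condNum Z ^ 2) ^ 2) * (2 * ‖Z‖ * ‖A‖) := by
        gcongr; exact norm_CZ_le hZ
      _ = _ := by ring
  have np : ‖p‖ ≤ beta Z * condNum Z * (1 + condNum Z ^ 4) * ‖A‖ := by
    have h1 := sylv hP2 p
    rw [add_comm, e_p] at h1
    calc ‖p‖ ≤ ‖(rho2 Z)⁻¹‖ / 2 * ‖g‖ := h1
      _ ≤ ‖Z⁻¹‖ / 2 * (beta Z * ((1 + condNum Z ^ 4) * (2 * ‖Z‖ * ‖A‖))) := by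
        gcongr
        · exact norm_rho2_inv_le hZ
        · exact ng.trans (by gcongr)
      _ = beta Z * (‖Z‖ * ‖Z⁻¹‖) * (1 + condNum Z ^ 4) * ‖A‖ := by ring
      _ = _ := by rw [← condNum]
  have hs : s = -((rho2 Z)⁻¹ * p * (rho1 Z * rho1 Z)) + (rho2 Z)⁻¹ * Aᴴ * (Z * (rho2 Z)⁻¹)
      + (Z * (rho2 Z)⁻¹)ᴴ * A * (rho2 Z)⁻¹ - rho1 Z * rho1 Z * p * (rho2 Z)⁻¹ := by
    rw [← e_s, hv, e_dH, rho1_sq hZ, conjTranspose_mul, hP2.inv.1.eq]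
    noncomm_ring
  have n1 : ‖rho1 Z * rho1 Z‖ = ‖rho1 Z‖ ^ 2 := by rw [herm_norm hP1.1, sq]
  have ns : ‖s‖ ≤ 2 * ‖(rho2 Z)⁻¹‖ * ‖rho1 Z‖ * ‖A‖ + 2 * ‖(rho2 Z)⁻¹‖ * ‖rho1 Z‖ ^ 2 * ‖p‖ := by
    rw [hs]
    refine (norm_sub_le _ _).trans ?_
    have a1 : ‖-((rho2 Z)⁻¹ * p * (rho1 Z * rho1 Z))‖ ≤ ‖(rho2 Z)⁻¹‖ * ‖p‖ * ‖rho1 Z‖ ^ 2 := by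
      rw [norm_neg, ← n1]; exact norm_mul₃_le
    have a2 : ‖(rho2 Z)⁻¹ * Aᴴ * (Z * (rho2 Z)⁻¹)‖ ≤ ‖(rho2 Z)⁻¹‖ * ‖A‖ * ‖rho1 Z‖ := by
      rw [← norm_Z_rho2_inv hZ, ← l2_opNorm_conjTranspose A]; exact norm_mul₃_le
    have a3 : ‖(Z * (rho2 Z)⁻¹)ᴴ * A * (rho2 Z)⁻¹‖ ≤ ‖rho1 Z‖ * ‖A‖ * ‖(rho2 Z)⁻¹‖ := by
      rw [← norm_Z_rho2_inv hZ, ← l2_opNorm_conjTranspose (Z * (rho2 Z)⁻¹)]; exact norm_mul₃_le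
    have a4 : ‖rho1 Z * rho1 Z * p * (rho2 Z)⁻¹‖ ≤ ‖rho1 Z‖ ^ 2 * ‖p‖ * ‖(rho2 Z)⁻¹‖ := by
      rw [← n1]; exact norm_mul₃_le
    have b1 := norm_add_le (-((rho2 Z)⁻¹ * p * (rho1 Z * rho1 Z)) + (rho2 Z)⁻¹ * Aᴴ * (Z * (rho2 Z)⁻¹))
      ((Z * (rho2 Z)⁻¹)ᴴ * A * (rho2 Z)⁻¹)
    have b2 := norm_add_le (-((rho2 Z)⁻¹ * p * (rho1 Z * rho1 Z)))
      ((rho2 Z)⁻¹ * Aᴴ * (Z * (rho2 Z)⁻¹))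
    linarith
  have h1 := sylv hP1 d
  rw [add_comm, e_d, norm_rho1_inv hZ] at h1
  calc ‖d‖ ≤ ‖rho1 Z‖ / 2 * ‖s‖ := h1
    _ ≤ ‖rho1 Z‖ / 2 * (2 * ‖(rho2 Z)⁻¹‖ * ‖rho1 Z‖ * ‖A‖ + 2 * ‖(rho2 Z)⁻¹‖ * ‖rho1 Z‖ ^ 2 *
        (beta Z * condNum Z * (1 + condNum Z ^ 4) * ‖A‖)) := by
      gcongr
      exact ns.trans (by gcongr)
    _ = _ := by ring

lemma mul_rule {f g : ℝ → Mat n} {f' g' : Mat n} (hf : HasDerivAt f f' 0)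
    (hg : HasDerivAt g g' 0) :
    HasDerivAt (fun t => f t * g t) (f' * g 0 + f 0 * g') 0 := hf.mul hg

lemma const_rule : HasDerivAt (fun _ : ℝ => (1 : Mat n)) 0 0 := hasDerivAt_const _ _

lemma inv_rule {H : ℝ → Mat n} {h : Mat n} (hH : HasDerivAt H h 0) (p : (H 0).PosDef) :
    ∃ x, HasDerivAt (fun t => (H t)⁻¹) x 0 :=
  ⟨_, (diff_inv hH.differentiableAt p.isUnit).hasDerivAt⟩

lemma curve_eqs {H K G P R : ℝ → Mat n} {h k d : Mat n}
    (dH : HasDerivAt H h 0) (dK : HasDerivAt K k 0) (dG : DifferentiableAt ℝ G 0)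
    (dP : DifferentiableAt ℝ P 0) (dR : HasDerivAt R d 0)
    (pH : ∀ᶠ t in 𝓝 0, (H t).PosDef) (pP : ∀ᶠ t in 𝓝 0, (P t).PosDef)
    (rG : ∀ᶠ t in 𝓝 0, G t * (H t)⁻¹ * G t = K t)
    (r1 : ∀ᶠ t in 𝓝 0, P t * P t = G t)
    (r2 : ∀ᶠ t in 𝓝 0, R t * R t = (P t)⁻¹ * H t * (P t)⁻¹) :
    ∃ g q p v s : Mat n, q * H 0 + (H 0)⁻¹ * h = 0 ∧
      (g * (H 0)⁻¹ + G 0 * q) * G 0 + G 0 * (H 0)⁻¹ * g = k ∧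
      p * P 0 + P 0 * p = g ∧
      v * P 0 + (P 0)⁻¹ * p = 0 ∧
      (v * H 0 + (P 0)⁻¹ * h) * (P 0)⁻¹ + (P 0)⁻¹ * H 0 * v = s ∧
      d * R 0 + R 0 * d = s := by
  obtain ⟨g, hG⟩ : ∃ x, HasDerivAt G x 0 := ⟨_, dG.hasDerivAt⟩
  obtain ⟨p, hP⟩ : ∃ x, HasDerivAt P x 0 := ⟨_, dP.hasDerivAt⟩
  obtain ⟨q, hQ⟩ := inv_rule dH pH.self_of_nhds
  obtain ⟨v, hV⟩ := inv_rule hP pP.self_of_nhds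
  have hVH := mul_rule hV dH
  have hGQ := mul_rule hG hQ
  have hS := mul_rule hVH hV
  have e1 := prod_rule hQ dH const_rule
      (pH.mono fun t ht => nonsing_inv_mul _ (det_unit ht))
  have e2 := prod_rule hGQ hG dK rG
  have e3 := prod_rule hP hP hG r1
  have e4 := prod_rule hV hP const_rule
      (pP.mono fun t ht => nonsing_inv_mul _ (det_unit ht))
  have e5 := prod_rule dR dR hS r2
  exact ⟨g, q, p, v, _, e1, e2, e3, e4, rfl, e5⟩

lemma curve_bound {Z : Mat n} (hZ : IsUnit Z) (A d : Mat n) (c : ℝ → Mat n) (c0 : c 0 = Z)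
    (hcd : HasDerivAt c A 0) (hd : HasDerivAt (fun t : ℝ => rho1 (c t)) d 0) :
    ‖d‖ ≤ ‖rho1 Z‖ ^ 2 * ‖(rho2 Z)⁻¹‖ *
        (1 + ‖rho1 Z‖ * beta Z * condNum Z * (1 + condNum Z ^ 4)) * ‖A‖ := by
  have hu : ∀ᶠ t in 𝓝 0, IsUnit (c t) := by
    have h1 : {x : Mat n | IsUnit x} ∈ 𝓝 (c 0) := by
      rw [c0]; exact Units.isOpen.mem_nhds hZ
    exact hcd.continuousAt.eventually h1
  have dH : HasDerivAt (fun t => (c t)ᴴ * c t) (Aᴴ * Z + Zᴴ * A) 0 := by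
    have := (hcd.star).mul hcd
    rw [c0] at this
    exact this
  have pH : ∀ᶠ t in 𝓝 0, ((c t)ᴴ * c t).PosDef := hu.mono fun t ht => H_posDef ht
  have pR : ∀ᶠ t in 𝓝 0, (rho2 (c t)).PosDef := hu.mono fun t ht => rho2_posDef ht
  have r1 : ∀ᶠ t in 𝓝 0, rho2 (c t) * rho2 (c t) =
    gm ((c t)ᴴ * c t) (mconj ((c t)ᴴ * c t)) := hu.mono fun t ht => rho2_sq ht
  have r2 : ∀ᶠ t in 𝓝 0, rho1 (c t) * rho1 (c t) =
    (rho2 (c t))⁻¹ * ((c t)ᴴ * c t) * (rho2 (c t))⁻¹ := hu.mono fun t ht => rho1_sq ht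
  have r3 : ∀ t, rho2 (c t) = psqrt (gm ((c t)ᴴ * c t) (mconj ((c t)ᴴ * c t))) := fun t => rfl
  generalize hHdef : (fun t => (c t)ᴴ * c t) = H at dH
  have hH' : ∀ t, (c t)ᴴ * c t = H t := fun t => congrFun hHdef t
  simp only [hH'] at pH r1 r2 r3
  have dK := mconj_hasDerivAt dH
  have pK : ∀ᶠ t in 𝓝 0, (mconj (H t)).PosDef := pH.mono fun t ht => mconj_posDef ht
  have dG := gm_diff dH.differentiableAt dK.differentiableAt pH pK
  have dP : DifferentiableAt ℝ (fun t => rho2 (c t)) 0 := by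
    simp only [r3]
    exact psqrt_diff dG (by filter_upwards [pH, pK] with t h k using gm_posDef h k)
  have rG : ∀ᶠ t in 𝓝 0, gm (H t) (mconj (H t)) * (H t)⁻¹ * gm (H t) (mconj (H t)) =
      mconj (H t) := by
    filter_upwards [pH, pK] with t h k using gm_riccati h k
  obtain ⟨g, q, p, v, s, e_q, e_g, e_p, e_v, e_s, e_d⟩ := curve_eqs dH dK dG dP hd pH pR rG r1 r2
  have hH0 : H 0 = Zᴴ * Z := by rw [← hH' 0, c0]
  simp only [hH0, c0] at e_q e_g e_p e_v e_s e_d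
  exact main_bound_s15 hZ A _ _ g q p v s d rfl rfl e_q e_g e_p e_v e_s e_d

end helpers
/-- bound on the derivative of `ρ₁`:
`‖D(A)‖ ≤ ‖P₁‖² ‖P₂⁻¹‖ (1 + ‖P₁‖ β(Z) cond(Z) (1 + cond(Z)⁴)) ‖A‖`
where `P₁ = ρ₁(Z)`, `P₂ = ρ₂(Z)`. -/
theorem stmt15 {n : ℕ} (hn : 0 < n) (Z : Matrix (Fin n) (Fin n) ℂ) (hZ : IsUnit Z)
    (D : Matrix (Fin n) (Fin n) ℂ →L[ℝ] Matrix (Fin n) (Fin n) ℂ)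
    (hD : HasFDerivAt (rho1 (n := n)) D Z) :
    ∀ A : Matrix (Fin n) (Fin n) ℂ,
      ‖D A‖ ≤ ‖rho1 Z‖ ^ 2 * ‖(rho2 Z)⁻¹‖ *
        (1 + ‖rho1 Z‖ * beta Z * condNum Z * (1 + condNum Z ^ 4)) * ‖A‖ := by
  intro A
  have h1 : HasDerivAt (fun t : ℝ => Z + t • A) A 0 := by
    have := ((hasDerivAt_id (0 : ℝ)).smul_const A).const_add Z
    rw [one_smul] at this
    exact this
  have h0 : (fun t : ℝ => Z + t • A) 0 = Z := by simp
  refine curve_bound hZ A (D A) (fun t : ℝ => Z + t • A) h0 h1 ?_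
  have h2 : HasFDerivAt (rho1 (n := n)) D ((fun t : ℝ => Z + t • A) 0) := by rw [h0]; exact hD
  exact HasFDerivAt.comp_hasDerivAt (l := rho1 (n := n)) (f := fun t : ℝ => Z + t • A) (0 : ℝ) h2 h1
end
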